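/- Let A = 3.0610046·10^{10}, T = 6970346000, α = 1153308722614227968, η = 933831/2^{44}, and ω = 727.951332655, and define K(y) = √(α/(2π))·exp(−α y²/2). Assume that every nontrivial zero ρ of the Riemann zeta function with |Im ρ| ≤ A satisfies Re ρ = 1/2, and assume that the real number Re(∑_{ρ : |Im ρ| ≤ T} (e^{i(Im ρ)ω}/ρ)·e^{−(Im ρ)²/(2α)}), where the sum is over nontrivial zeros counted with multiplicity, lies in the interval [−1.0013360278, −1.0013360277]. Then ∫_{ω−η}^{ω+η} K(u−ω)·e^{−u/2}·(θ(e^u) − e^u) du > 0.0013360261. -/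

import Mathlib

open Real Finset

/-- The Chebyshev function `θ(x) = ∑_{p ≤ x, p prime} log p`. -/
noncomputable def chebyshevTheta (x : ℝ) : ℝ :=
  ∑ p ∈ (Finset.range (⌊x⌋₊ + 1)).filter Nat.Prime, Real.log p

/-- `ρ` is a nontrivial zero of the Riemann zeta function. -/
def IsNontrivialZetaZero (ρ : ℂ) : Prop :=
  riemannZeta ρ = 0 ∧ 0 < ρ.re ∧ ρ.re < 1

open Classical in
/-- The multiplicity of `ρ` as a zero of the Riemann zeta function. -/
noncomputable def zetaZeroMultiplicity (ρ : ℂ) : ℕ :=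
  if h : AnalyticAt ℂ riemannZeta ρ then (analyticOrderAt riemannZeta ρ).toNat else 0

/-- The Gaussian kernel `K(y) = √(α/(2π)) exp(-αy²/2)`. -/
noncomputable def gaussianK (α y : ℝ) : ℝ :=
  Real.sqrt (α / (2 * π)) * Real.exp (-α * y ^ 2 / 2)

namespace ZB
open MeasureTheory Filter
open scoped Topology

/-- The entire function `(s-1) ζ(s)`. -/
noncomputable def zf : ℂ → ℂ := Function.update (fun s => (s - 1) * riemannZeta s) 1 1

lemma zf_one : zf 1 = 1 := by simp [zf]

lemma zf_of_ne {s : ℂ} (hs : s ≠ 1) : zf s = (s - 1) * riemannZeta s := by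
  simp [zf, Function.update_of_ne hs]

lemma zf_differentiable : Differentiable ℂ zf := by
  intro s
  by_cases hs : s = 1
  · subst hs
    apply AnalyticAt.differentiableAt
    apply Complex.analyticAt_of_differentiable_on_punctured_nhds_of_continuousAt
    · filter_upwards [self_mem_nhdsWithin] with z hz
      have hz' : z ≠ 1 := hz
      have : zf =ᶠ[𝓝 z] fun s => (s - 1) * riemannZeta s := by
        filter_upwards [isOpen_ne.mem_nhds hz'] with w hw using zf_of_ne hw
      refine DifferentiableAt.congr_of_eventuallyEq ?_ this
      exact (by fun_prop : DifferentiableAt ℂ (fun s : ℂ => s - 1) z).mul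
        (differentiableAt_riemannZeta hz')
    · unfold zf
      rw [continuousAt_update_same]
      exact riemannZeta_residue_one
  · have : zf =ᶠ[𝓝 s] fun s => (s - 1) * riemannZeta s := by
      filter_upwards [isOpen_ne.mem_nhds hs] with w hw using zf_of_ne hw
    refine DifferentiableAt.congr_of_eventuallyEq ?_ this
    exact (by fun_prop : DifferentiableAt ℂ (fun s : ℂ => s - 1) s).mul
      (differentiableAt_riemannZeta hs)

/-- fractional part cut off to `x > 1`. -/
noncomputable def frc (x : ℝ) : ℂ := Set.indicator (Set.Ioi (1:ℝ)) (fun x => ((Int.fract x : ℝ) : ℂ)) x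

lemma frc_norm (x : ℝ) : ‖frc x‖ ≤ 1 := by
  unfold frc
  by_cases hx : x ∈ Set.Ioi (1:ℝ)
  · rw [Set.indicator_of_mem hx, Complex.norm_real, Real.norm_of_nonneg (Int.fract_nonneg x)]
    exact (Int.fract_lt_one x).le
  · rw [Set.indicator_of_notMem hx]; simp

lemma frc_meas : Measurable frc := by
  unfold frc
  exact (Complex.measurable_ofReal.comp measurable_fract).indicator measurableSet_Ioi

lemma mellin_frc_diff {w : ℂ} (hw : w.re < 0) : DifferentiableAt ℂ (mellin frc) w := by
  refine mellin_differentiableAt_of_isBigO_rpow (a := 0) (b := w.re - 1) ?_ ?_ hw ?_ (by linarith)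
  · apply LocallyIntegrable.locallyIntegrableOn
    have : LocallyIntegrable (fun _ : ℝ => (1:ℝ)) volume := continuous_const.locallyIntegrable
    refine this.mono frc_meas.aestronglyMeasurable ?_
    filter_upwards with x
    simpa using frc_norm x
  · simp only [neg_zero, Real.rpow_zero]
    apply Asymptotics.isBigO_of_le
    intro x; simpa using frc_norm x
  · have : frc =ᶠ[𝓝[>] 0] fun _ => 0 := by
      filter_upwards [mem_nhdsWithin_of_mem_nhds (Iio_mem_nhds (show (0:ℝ) < 1 by norm_num))] with x hx
      unfold frc
      rw [Set.indicator_of_notMem]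
      simp only [Set.mem_Ioi, not_lt]; exact le_of_lt hx
    exact this.trans_isBigO (Asymptotics.isBigO_zero _ _)

lemma mellin_frc_eq (s : ℂ) : mellin frc (-s) = ∫ t in Set.Ioi (1:ℝ), ((Int.fract t : ℝ) : ℂ) * (t:ℂ) ^ (-(s+1)) := by
  unfold mellin
  have : ∀ t : ℝ, (t:ℂ) ^ (-s - 1) • frc t = Set.indicator (Set.Ioi (1:ℝ)) (fun t => ((Int.fract t : ℝ) : ℂ) * (t:ℂ) ^ (-(s+1))) t := by
    intro t
    unfold frc
    by_cases ht : t ∈ Set.Ioi (1:ℝ)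
    · rw [Set.indicator_of_mem ht, Set.indicator_of_mem ht, smul_eq_mul, mul_comm]
      congr 2; ring
    · rw [Set.indicator_of_notMem ht, Set.indicator_of_notMem ht]; simp
  simp_rw [this]
  rw [integral_indicator measurableSet_Ioi, Measure.restrict_restrict measurableSet_Ioi]
  congr 2
  rw [Set.inter_eq_left.mpr]
  intro x hx; exact lt_trans one_pos (show (1:ℝ) < x from hx)

lemma mellin_frc_norm {s : ℂ} (hs : 0 < s.re) : ‖mellin frc (-s)‖ ≤ 1 / s.re := by
  rw [mellin_frc_eq]
  have hI : IntegrableOn (fun t : ℝ => t ^ (-s.re - 1)) (Set.Ioi 1) :=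
    integrableOn_Ioi_rpow_of_lt (by linarith) one_pos
  calc _ ≤ ∫ t in Set.Ioi (1:ℝ), t ^ (-s.re - 1) := by
        apply norm_integral_le_of_norm_le hI
        filter_upwards [self_mem_ae_restrict measurableSet_Ioi] with t ht
        have ht' : (1:ℝ) < t := ht
        rw [norm_mul, Complex.norm_cpow_eq_rpow_re_of_pos (by linarith), Complex.norm_real,
          Real.norm_of_nonneg (Int.fract_nonneg t)]
        have : (-(s+1)).re = -s.re - 1 := by simp [sub_eq_add_neg, add_comm]
        rw [this]
        have h1 := (Int.fract_lt_one t).le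
        have h2 : 0 ≤ t ^ (-s.re - 1) := by positivity
        nlinarith
    _ = 1 / s.re := by
        rw [integral_Ioi_rpow_of_lt (by linarith) one_pos]
        simp

lemma zf_eq_of_one_lt {s : ℂ} (hs : 1 < s.re) : zf s = s - s * (s - 1) * mellin frc (-s) := by
  have hs1 : s ≠ 1 := by rintro rfl; simp at hs
  have hs1' : s - 1 ≠ 0 := sub_ne_zero.mpr hs1
  have h := LSeries_eq_mul_integral_of_nonneg (fun _ => (1:ℝ)) (r := 1) zero_le_one (s := s) hs
    (by simp only [sum_const, Nat.card_Icc, add_tsub_cancel_right, nsmul_eq_mul, mul_one,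
          Real.rpow_one]; exact Asymptotics.isBigO_refl _ _) (fun _ => zero_le_one)
  have hL : LSeries (fun n => (((fun _ : ℕ => (1:ℝ)) n : ℝ) : ℂ)) s = riemannZeta s := by
    rw [← LSeries_one_eq_riemannZeta hs]
    congr 1
  rw [hL] at h
  have hI1 : ∫ t in Set.Ioi (1:ℝ), (t:ℂ) ^ (-s) = 1 / (s - 1) := by
    rw [integral_Ioi_cpow_of_lt (by simpa using hs) one_pos]
    simp only [Complex.ofReal_one, Complex.one_cpow]
    rw [neg_div, ← div_neg]; congr 1; ring
  have hi1 : IntegrableOn (fun t : ℝ => (t:ℂ) ^ (-s)) (Set.Ioi 1) :=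
    integrableOn_Ioi_cpow_of_lt (by simpa using hs) one_pos
  have hi2 : IntegrableOn (fun t : ℝ => ((Int.fract t : ℝ) : ℂ) * (t:ℂ) ^ (-(s+1))) (Set.Ioi 1) := by
    have hi : IntegrableOn (fun t : ℝ => (t:ℂ) ^ (-(s+1))) (Set.Ioi 1) :=
      integrableOn_Ioi_cpow_of_lt (by simp; linarith) one_pos
    refine Integrable.bdd_mul (c := 1) hi ?_ ?_
    · exact (Complex.measurable_ofReal.comp measurable_fract).aestronglyMeasurable
    · filter_upwards with t
      rw [Complex.norm_real, Real.norm_of_nonneg (Int.fract_nonneg t)]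
      exact (Int.fract_lt_one t).le
  have hI : ∫ t in Set.Ioi (1:ℝ), (∑ k ∈ Finset.Icc 1 ⌊t⌋₊, (((fun _ : ℕ => (1:ℝ)) k : ℝ) : ℂ)) * (t:ℂ) ^ (-(s+1))
      = 1 / (s - 1) - mellin frc (-s) := by
    rw [mellin_frc_eq, ← hI1, ← integral_sub hi1 hi2]
    apply setIntegral_congr_fun measurableSet_Ioi
    intro t ht
    have ht' : (1:ℝ) < t := ht
    have ht0 : (t:ℂ) ≠ 0 := by exact_mod_cast (by linarith : t ≠ 0)
    simp only [Complex.ofReal_one, sum_const, Nat.card_Icc, add_tsub_cancel_right, nsmul_eq_mul, mul_one]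
    have e1 : (t:ℂ) ^ (-s) = t * (t:ℂ) ^ (-(s+1)) := by
      rw [show -s = 1 + (-(s+1)) by ring, Complex.cpow_add _ _ ht0, Complex.cpow_one]
    rw [e1, ← sub_mul]
    congr 1
    have : ((⌊t⌋₊ : ℕ) : ℝ) = t - Int.fract t := by
      rw [natCast_floor_eq_intCast_floor (by linarith)]
      linarith [Int.fract_add_floor t]
    exact_mod_cast this
  rw [hI] at h
  rw [zf_of_ne hs1, h]
  field_simp

lemma zf_eq {s : ℂ} (hs : 0 < s.re) : zf s = s - s * (s - 1) * mellin frc (-s) := by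
  have hU : IsOpen {s : ℂ | 0 < s.re} := isOpen_lt continuous_const Complex.continuous_re
  have h1 : AnalyticOnNhd ℂ zf {s : ℂ | 0 < s.re} :=
    zf_differentiable.differentiableOn.analyticOnNhd hU
  have h2 : AnalyticOnNhd ℂ (fun s => s - s * (s - 1) * mellin frc (-s)) {s : ℂ | 0 < s.re} := by
    apply DifferentiableOn.analyticOnNhd _ hU
    intro z hz
    have hz' : 0 < z.re := hz
    have : DifferentiableAt ℂ (fun s => mellin frc (-s)) z :=
      (mellin_frc_diff (w := -z) (by simpa using hz')).comp z differentiableAt_id.neg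
    apply DifferentiableAt.differentiableWithinAt
    fun_prop
  refine h1.eqOn_of_preconnected_of_eventuallyEq h2 (convex_halfSpace_re_gt 0).isPreconnected
    (z₀ := 2) (by simp) ?_ hs
  filter_upwards [(isOpen_lt continuous_const Complex.continuous_re : IsOpen {s : ℂ | 1 < s.re}).mem_nhds
    (show (2:ℂ) ∈ {s : ℂ | 1 < s.re} by simp)] with z hz
  exact zf_eq_of_one_lt hz

lemma zf_norm_le {s : ℂ} (hs : 0 < s.re) : ‖zf s‖ ≤ ‖s‖ * (1 + ‖s - 1‖ / s.re) := by
  rw [zf_eq hs]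
  calc _ ≤ ‖s‖ + ‖s * (s-1) * mellin frc (-s)‖ := norm_sub_le _ _
    _ ≤ ‖s‖ + ‖s‖ * ‖s-1‖ * (1 / s.re) := by
      rw [norm_mul, norm_mul]; gcongr; exact mellin_frc_norm hs
    _ = _ := by ring

/-- the real value of zeta bounded by `σ/(σ-1)`. -/
lemma tsum_le {σ : ℝ} (hσ : 1 < σ) : ∑' n : ℕ, ‖LSeries.term 1 (σ:ℂ) n‖ ≤ σ / (σ - 1) := by
  have hσc : 1 < ((σ:ℂ)).re := by simpa using hσ
  have e0 : ∀ n : ℕ, LSeries.term 1 (σ:ℂ) n = ((‖LSeries.term 1 (σ:ℂ) n‖ : ℝ) : ℂ) := by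
    intro n
    rcases Nat.eq_zero_or_pos n with rfl | hn
    · simp
    · rw [LSeries.term_of_ne_zero hn.ne', norm_div, Complex.norm_natCast_cpow_of_pos hn]
      simp only [Pi.one_apply, norm_one, Complex.ofReal_re]
      rw [Complex.ofReal_div, Complex.ofReal_cpow (by positivity)]
      simp
  have e1 : riemannZeta σ = ((∑' n : ℕ, ‖LSeries.term 1 (σ:ℂ) n‖ : ℝ) : ℂ) := by
    rw [← LSeries_one_eq_riemannZeta hσc, Complex.ofReal_tsum]
    exact tsum_congr e0
  have e2 := zf_eq_of_one_lt hσc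
  have hs1 : (σ:ℂ) ≠ 1 := by intro h; rw [h] at hσc; simp at hσc
  rw [zf_of_ne hs1, e1] at e2
  set Z := ∑' n : ℕ, ‖LSeries.term 1 (σ:ℂ) n‖
  have e3 : ∃ r : ℝ, 0 ≤ r ∧ mellin frc (-(σ:ℂ)) = r := by
    refine ⟨∫ t in Set.Ioi (1:ℝ), (Int.fract t) * t ^ (-(σ+1)), ?_, ?_⟩
    · apply setIntegral_nonneg measurableSet_Ioi
      intro t ht
      have : (0:ℝ) < t := lt_trans one_pos ht
      have := Int.fract_nonneg t
      positivity
    · rw [mellin_frc_eq, ← integral_complex_ofReal]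
      apply setIntegral_congr_fun measurableSet_Ioi
      intro t ht
      have : (0:ℝ) < t := lt_trans one_pos ht
      simp only [Complex.ofReal_mul]
      rw [Complex.ofReal_cpow this.le]
      simp
  obtain ⟨r, hr, e3⟩ := e3
  rw [e3] at e2
  have e4 : (σ - 1) * Z = σ - σ * (σ - 1) * r := by exact_mod_cast e2
  rw [le_div_iff₀ (by linarith)]
  have : 0 ≤ σ * (σ - 1) * r := by
    have : 0 ≤ σ - 1 := by linarith
    positivity
  linarith

lemma term_bound (f : ℕ → ℂ) (hf : ∀ n, ‖f n‖ ≤ 1) {s : ℂ} (hs : 1 < s.re) :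
    ‖LSeries f s‖ ≤ s.re / (s.re - 1) := by
  refine le_trans ?_ (tsum_le hs)
  have hsum : Summable fun n => ‖LSeries.term 1 (s.re:ℂ) n‖ := by
    have : LSeriesSummable 1 (s.re : ℂ) := LSeriesSummable_one_iff.mpr (by simpa using hs)
    exact this.norm
  apply tsum_of_norm_bounded hsum.hasSum
  intro n
  rcases Nat.eq_zero_or_pos n with rfl | hn
  · simp
  · rw [LSeries.term_of_ne_zero hn.ne', LSeries.term_of_ne_zero hn.ne', norm_div, norm_div,
      Complex.norm_natCast_cpow_of_pos hn, Complex.norm_natCast_cpow_of_pos hn]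
    simp only [Pi.one_apply, norm_one, Complex.ofReal_re]
    gcongr
    exact hf n

lemma zeta_norm_le {s : ℂ} (hs : 1 < s.re) : ‖riemannZeta s‖ ≤ s.re / (s.re - 1) := by
  rw [← LSeries_one_eq_riemannZeta hs]
  exact term_bound 1 (by simp) hs

lemma zeta_norm_ge {s : ℂ} (hs : 1 < s.re) : (s.re - 1) / s.re ≤ ‖riemannZeta s‖ := by
  have h := ArithmeticFunction.LSeries_zeta_mul_Lseries_moebius hs
  rw [ArithmeticFunction.LSeries_zeta_eq_riemannZeta hs] at h
  have h1 := term_bound (fun n => ((ArithmeticFunction.moebius n : ℤ) : ℂ)) (fun n => by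
    rw [Complex.norm_intCast]; exact_mod_cast ArithmeticFunction.abs_moebius_le_one) hs
  have h2 : ‖riemannZeta s‖ * ‖LSeries (fun n => ((ArithmeticFunction.moebius n : ℤ) : ℂ)) s‖ = 1 := by
    rw [← norm_mul, h, norm_one]
  have h3 : 1 ≤ ‖riemannZeta s‖ * (s.re / (s.re - 1)) := by
    calc (1:ℝ) = _ := h2.symm
      _ ≤ _ := by gcongr
  have hp : 0 < s.re - 1 := by linarith
  have hp2 : 0 < s.re := by linarith
  rw [div_le_iff₀ hp2]
  rw [← mul_div_assoc, le_div_iff₀ hp] at h3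
  linarith

end ZB

namespace ZB
open MeasureTheory Filter
open scoped Topology

lemma factor_one {f : ℂ → ℂ} (hf : Differentiable ℂ f) (ρ : ℂ) (h : analyticOrderAt f ρ ≠ ⊤) :
    ∃ g : ℂ → ℂ, Differentiable ℂ g ∧ g ρ ≠ 0 ∧
      ∀ s, f s = (s - ρ) ^ (analyticOrderNatAt f ρ) * g s := by
  obtain ⟨g0, han, hne, hev⟩ := ((hf.analyticAt ρ).analyticOrderAt_ne_top).1 h
  set n := analyticOrderNatAt f ρ
  have key : ∀ s, s ≠ ρ → Function.update (fun s => f s / (s - ρ) ^ n) ρ (g0 ρ) s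
      = f s / (s - ρ) ^ n := fun s hs => Function.update_of_ne hs _ _
  refine ⟨Function.update (fun s => f s / (s - ρ) ^ n) ρ (g0 ρ), ?_, ?_, ?_⟩
  · intro s
    by_cases hs : s = ρ
    · subst hs
      refine han.differentiableAt.congr_of_eventuallyEq ?_
      filter_upwards [hev] with z hz
      by_cases hzs : z = s
      · subst hzs; simp
      · rw [key z hzs, hz, smul_eq_mul, mul_div_cancel_left₀]
        exact pow_ne_zero _ (sub_ne_zero.mpr hzs)
    · have : Function.update (fun s => f s / (s - ρ) ^ n) ρ (g0 ρ) =ᶠ[𝓝 s]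
          fun s => f s / (s - ρ) ^ n := by
        filter_upwards [isOpen_ne.mem_nhds hs] with w hw using key w hw
      refine DifferentiableAt.congr_of_eventuallyEq ?_ this
      exact (hf s).div (by fun_prop) (pow_ne_zero _ (sub_ne_zero.mpr hs))
  · simpa using hne
  · intro s
    by_cases hs : s = ρ
    · subst hs; simpa using hev.self_of_nhds
    · rw [key s hs, mul_div_cancel₀]
      exact pow_ne_zero _ (sub_ne_zero.mpr hs)

lemma factor {f : ℂ → ℂ} (hf : Differentiable ℂ f) (h : ∀ ρ, analyticOrderAt f ρ ≠ ⊤)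
    (Z : Finset ℂ) :
    ∃ g : ℂ → ℂ, Differentiable ℂ g ∧ (∀ ρ ∈ Z, g ρ ≠ 0) ∧
      ∀ s, f s = (∏ ρ ∈ Z, (s - ρ) ^ (analyticOrderNatAt f ρ)) * g s := by
  classical
  induction Z using Finset.induction_on with
  | empty => exact ⟨f, hf, by simp, by simp⟩
  | insert a Z ha ih =>
    obtain ⟨g, hg, hgZ, hfg⟩ := ih
    set P : ℂ → ℂ := fun s => ∏ ρ ∈ Z, (s - ρ) ^ (analyticOrderNatAt f ρ) with hP
    have hPd : Differentiable ℂ P := by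
      simp only [hP]; fun_prop
    have hPa : P a ≠ 0 := by
      simp only [hP]
      rw [Finset.prod_ne_zero_iff]
      intro ρ hρ
      exact pow_ne_zero _ (sub_ne_zero.mpr (by rintro rfl; exact ha hρ))
    have hord : analyticOrderAt f a = analyticOrderAt g a := by
      have : f = P * g := by ext s; exact hfg s
      rw [this, analyticOrderAt_mul (hPd.analyticAt a) (hg.analyticAt a),
        ((hPd.analyticAt a).analyticOrderAt_eq_zero).2 hPa, zero_add]
    obtain ⟨g', hg', hga, hgg⟩ := factor_one hg a (hord ▸ h a)
    refine ⟨g', hg', ?_, ?_⟩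
    · intro ρ hρ
      rcases Finset.mem_insert.1 hρ with rfl | hρ
      · exact hga
      · intro h0
        exact hgZ ρ hρ (by rw [hgg, h0, mul_zero])
    · intro s
      have hn : analyticOrderNatAt f a = analyticOrderNatAt g a := by
        simp only [analyticOrderNatAt, hord]
      rw [Finset.prod_insert ha, hfg s, hgg s, hn]; ring

lemma zf_order_ne_top (ρ : ℂ) : analyticOrderAt zf ρ ≠ ⊤ := by
  have h1 : analyticOrderAt zf 1 ≠ ⊤ := by
    rw [((zf_differentiable.analyticAt 1).analyticOrderAt_eq_zero).2 (by simp [zf_one])]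
    simp
  exact AnalyticOnNhd.analyticOrderAt_ne_top_of_isPreconnected
    (fun z _ => zf_differentiable.analyticAt z) isPreconnected_univ (Set.mem_univ 1)
    (Set.mem_univ ρ) h1

/-- multiplicity of a zero of `zf`. -/
noncomputable def mu (ρ : ℂ) : ℕ := analyticOrderNatAt zf ρ

lemma mu_pos {ρ : ℂ} (h : zf ρ = 0) : 1 ≤ mu ρ := by
  unfold mu
  have h1 := ((zf_differentiable.analyticAt ρ).analyticOrderAt_ne_zero).2 h
  rw [← Nat.cast_analyticOrderNatAt (zf_order_ne_top ρ)] at h1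
  have : analyticOrderNatAt zf ρ ≠ 0 := by exact_mod_cast h1
  omega

lemma zf_zero_iff {ρ : ℂ} : zf ρ = 0 ↔ ρ ≠ 1 ∧ riemannZeta ρ = 0 := by
  by_cases h : ρ = 1
  · subst h; simp [zf_one]
  · rw [zf_of_ne h]; simp [h, sub_eq_zero]

lemma mu_eq {ρ : ℂ} (h : ρ ≠ 1) : mu ρ = zetaZeroMultiplicity ρ := by
  have hz : AnalyticAt ℂ riemannZeta ρ := by
    rw [Complex.analyticAt_iff_eventually_differentiableAt]
    filter_upwards [isOpen_ne.mem_nhds h] with w hw using differentiableAt_riemannZeta hw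
  have hs : AnalyticAt ℂ (fun s : ℂ => s - 1) ρ := by fun_prop
  unfold mu zetaZeroMultiplicity analyticOrderNatAt
  rw [dif_pos hz]
  congr 1
  have : zf =ᶠ[𝓝 ρ] (fun s => s - 1) * riemannZeta := by
    filter_upwards [isOpen_ne.mem_nhds h] with w hw using zf_of_ne hw
  rw [analyticOrderAt_congr this, analyticOrderAt_mul hs hz,
    (hs.analyticOrderAt_eq_zero).2 (sub_ne_zero.mpr h), zero_add]

lemma zeros_finite {S : Set ℂ} (hS : IsCompact S) : (S ∩ {ρ | zf ρ = 0}).Finite := by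
  refine hS.inter_riemannZetaZeros_finite.subset ?_
  intro ρ hρ
  exact ⟨hρ.1, (zf_zero_iff.1 hρ.2).2⟩

lemma zf_ne_zero_of_re {s : ℂ} (hs : 1 ≤ s.re) : zf s ≠ 0 := by
  intro h
  exact riemannZeta_ne_zero_of_one_le_re hs (zf_zero_iff.1 h).2

lemma nontriv_iff {ρ : ℂ} : IsNontrivialZetaZero ρ ↔ zf ρ = 0 ∧ 0 < ρ.re := by
  constructor
  · rintro ⟨h1, h2, h3⟩
    exact ⟨zf_zero_iff.2 ⟨by rintro rfl; simp at h3, h1⟩, h2⟩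
  · rintro ⟨h1, h2⟩
    refine ⟨(zf_zero_iff.1 h1).2, h2, ?_⟩
    by_contra h3
    exact zf_ne_zero_of_re (not_lt.1 h3) h1

end ZB

namespace ZB
open MeasureTheory Filter
open scoped Topology

lemma zf_circleInt (c : ℂ) (R : ℝ) : CircleIntegrable (fun z => Real.log ‖zf z‖) c R :=
  MeromorphicOn.circleIntegrable_log_norm
    (fun z _ => (zf_differentiable.analyticAt z).meromorphicAt)

lemma jensen {c : ℂ} {R : ℝ} (hR : 0 < R) (hc : zf c ≠ 0) (Z : Finset ℂ)
    (hZ : ∀ ρ ∈ Z, ρ ∈ Metric.closedBall c R) :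
    ∑ ρ ∈ Z, (mu ρ : ℝ) * Real.log (R / ‖ρ - c‖) ≤
      circleAverage (fun z => Real.log ‖zf z‖) c R - Real.log ‖zf c‖ := by
  classical
  have hmer : MeromorphicOn zf (Metric.closedBall c |R|) :=
    fun z _ => (zf_differentiable.analyticAt z).meromorphicAt
  have h := MeromorphicOn.circleAverage_log_norm hR.ne' hmer
  rw [abs_of_pos hR] at h
  set D := MeromorphicOn.divisor zf (Metric.closedBall c R) with hD
  have han : AnalyticOnNhd ℂ zf (Metric.closedBall c R) :=
    fun z _ => zf_differentiable.analyticAt z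
  have hval : ∀ z ∈ Metric.closedBall c R, D z = (mu z : ℤ) := by
    intro z hz
    rw [hD, MeromorphicOn.AnalyticOnNhd.divisor_apply han hz,
      ← Nat.cast_analyticOrderNatAt (zf_order_ne_top z)]
    simp [mu]
  have hout : ∀ z, z ∉ Metric.closedBall c R → D z = 0 := fun z hz =>
    D.apply_eq_zero_of_notMem hz
  have hcc : c ∈ Metric.closedBall c R := Metric.mem_closedBall_self hR.le
  have hDc : D c = 0 := by
    rw [hval c hcc]
    have : analyticOrderAt zf c = 0 :=
      ((zf_differentiable.analyticAt c).analyticOrderAt_eq_zero).2 hc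
    simp [mu, analyticOrderNatAt, this]
  rw [hDc, AnalyticAt.meromorphicTrailingCoeffAt_of_ne_zero (zf_differentiable.analyticAt c) hc] at h
  have hnn : ∀ u, 0 ≤ (D u : ℝ) * Real.log (R * ‖c - u‖⁻¹) := by
    intro u
    by_cases hu : u ∈ Metric.closedBall c R
    · rcases eq_or_ne u c with rfl | hne
      · simp [hDc]
      · apply mul_nonneg
        · rw [hval u hu]; positivity
        · apply Real.log_nonneg
          have : ‖c - u‖ ≤ R := by rwa [← dist_eq_norm, dist_comm, ← Metric.mem_closedBall]
          have h0 : 0 < ‖c - u‖ := norm_pos_iff.2 (sub_ne_zero.2 hne.symm)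
          rw [← div_eq_mul_inv, le_div_iff₀ h0]; linarith
    · simp [hout u hu]
  have hfin : (Function.support fun u => (D u : ℝ) * Real.log (R * ‖c - u‖⁻¹)).Finite := by
    have : (Function.support D).Finite := D.finiteSupport (isCompact_closedBall c R)
    refine this.subset ?_
    intro u hu hu0
    apply hu
    have : D u = 0 := hu0
    simp [this]
  have hle : ∑ ρ ∈ Z, (mu ρ : ℝ) * Real.log (R / ‖ρ - c‖) ≤
      ∑ᶠ u, (D u : ℝ) * Real.log (R * ‖c - u‖⁻¹) := by
    rw [finsum_eq_sum_of_support_subset (s := Z ∪ hfin.toFinset) _ (by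
      intro u hu; simp only [coe_union, Set.mem_union]; right; simpa using hu)]
    calc _ = ∑ u ∈ Z, (D u : ℝ) * Real.log (R * ‖c - u‖⁻¹) := by
          apply Finset.sum_congr rfl
          intro ρ hρ
          rw [hval ρ (hZ ρ hρ), norm_sub_rev, div_eq_mul_inv]; simp
      _ ≤ _ := Finset.sum_le_sum_of_subset_of_nonneg Finset.subset_union_left
          (fun u _ _ => hnn u)
  have h' : circleAverage (fun z => Real.log ‖zf z‖) c R =
    (∑ᶠ u, (D u : ℝ) * Real.log (R * ‖c - u‖⁻¹)) + Real.log ‖zf c‖ := by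
    rw [h]; simp
  linarith

lemma avg_half {f : ℂ → ℝ} {c : ℂ} {R : ℝ} (hR : 0 < R) (hf : CircleIntegrable f c R) {B1 B2 : ℝ}
    (h1 : ∀ z ∈ Metric.sphere c R, c.re ≤ z.re → f z ≤ B1)
    (h2 : ∀ z ∈ Metric.sphere c R, z.re ≤ c.re → f z ≤ B2) :
    circleAverage f c R ≤ (B1 + B2) / 2 := by
  rw [circleAverage_eq_integral_add (-(π/2))]
  set g : ℝ → ℝ := fun θ => f (circleMap c R (θ + -(π/2))) with hg
  have hper : Function.Periodic (fun θ => f (circleMap c R θ)) (2 * π) := fun θ => by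
    simp only [periodic_circleMap c R θ]
  have hIntg0 : ∀ a b, IntervalIntegrable (fun θ => f (circleMap c R θ)) volume a b :=
    fun a b => hper.intervalIntegrable₀ (by positivity) hf a b
  have hIntg : ∀ a b, IntervalIntegrable g volume a b := fun a b => by
    have := (hIntg0 (a + -(π/2)) (b + -(π/2))).comp_add_right (-(π/2))
    simpa using this
  have hs : ∀ θ, circleMap c R (θ + -(π/2)) ∈ Metric.sphere c R :=
    fun θ => circleMap_mem_sphere c hR.le _
  have hre : ∀ θ, (circleMap c R (θ + -(π/2))).re = c.re + R * Real.sin θ := by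
    intro θ
    rw [← Real.cos_sub_pi_div_two θ, ← sub_eq_add_neg]
    rw [circleMap, Complex.exp_mul_I, ← Complex.ofReal_cos, ← Complex.ofReal_sin,
      Complex.add_re, Complex.re_ofReal_mul, Complex.add_re, Complex.ofReal_re, Complex.mul_I_re,
      Complex.ofReal_im]
    ring
  have e1 : ∫ θ in (0:ℝ)..π, g θ ≤ ∫ θ in (0:ℝ)..π, B1 := by
    apply intervalIntegral.integral_mono_on pi_pos.le (hIntg _ _) (by simp)
    intro θ hθ
    apply h1 _ (hs θ)
    rw [hre]
    have := Real.sin_nonneg_of_mem_Icc hθ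
    nlinarith
  have e2 : ∫ θ in π..(2*π), g θ ≤ ∫ θ in π..(2*π), B2 := by
    apply intervalIntegral.integral_mono_on (by linarith [pi_pos]) (hIntg _ _) (by simp)
    intro θ hθ
    apply h2 _ (hs θ)
    rw [hre]
    have : Real.sin θ ≤ 0 := by
      rw [← neg_nonneg, ← Real.sin_sub_pi]
      exact Real.sin_nonneg_of_nonneg_of_le_pi (by linarith [hθ.1]) (by linarith [hθ.2])
    nlinarith
  have e3 := intervalIntegral.integral_add_adjacent_intervals (hIntg 0 π) (hIntg π (2*π))
  rw [← e3, smul_eq_mul]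
  simp only [intervalIntegral.integral_const, smul_eq_mul] at e1 e2
  rw [inv_mul_le_iff₀ (by positivity)]
  linarith

end ZB

namespace ZB
open MeasureTheory Filter
open scoped Topology

lemma exp_nat_lb (n : ℕ) : (2.718281828 : ℝ) ^ n ≤ Real.exp n := by
  rw [← Real.exp_one_pow]
  have := Real.exp_one_gt_d9
  gcongr
  linarith

lemma zf_center_lb {c : ℂ} (hc : 1 < c.re) : (c.re - 1) / c.re * ‖c - 1‖ ≤ ‖zf c‖ := by
  have h1 : c ≠ 1 := by rintro rfl; simp at hc
  rw [zf_of_ne h1, norm_mul, mul_comm]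
  exact mul_le_mul_of_nonneg_left (zeta_norm_ge hc) (norm_nonneg _)

lemma norm_mk_le (x y : ℝ) : ‖(⟨x, y⟩ : ℂ)‖ ≤ |x| + |y| := Complex.norm_le_abs_re_add_abs_im _

lemma zf_bound_ball {t : ℝ} (ht : |t| ≤ 30610047000) {z : ℂ}
    (hz : z ∈ Metric.closedBall (⟨2, t⟩ : ℂ) 1.9) : ‖zf z‖ ≤ 10 ^ 22 := by
  rw [Metric.mem_closedBall, dist_eq_norm] at hz
  have h1 : ‖z‖ ≤ 3.07 * 10 ^ 10 := by
    calc ‖z‖ = ‖(z - ⟨2, t⟩) + ⟨2, t⟩‖ := by ring_nf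
      _ ≤ ‖z - ⟨2, t⟩‖ + ‖(⟨2, t⟩ : ℂ)‖ := norm_add_le _ _
      _ ≤ 1.9 + (|2| + |t|) := add_le_add hz (norm_mk_le _ _)
      _ ≤ _ := by rw [abs_of_pos (by norm_num : (0:ℝ) < 2)]; norm_num at ht ⊢; linarith
  have h2 : ‖z - 1‖ ≤ 3.07 * 10 ^ 10 := by
    calc ‖z - 1‖ = ‖(z - ⟨2, t⟩) + (⟨2, t⟩ - 1)‖ := by ring_nf
      _ ≤ ‖z - ⟨2, t⟩‖ + ‖(⟨2, t⟩ - 1 : ℂ)‖ := norm_add_le _ _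
      _ ≤ 1.9 + (1 + |t|) := by
        refine add_le_add hz ((Complex.norm_le_abs_re_add_abs_im _).trans ?_)
        simp; norm_num
      _ ≤ _ := by norm_num at ht ⊢; linarith
  have h3 : 0.1 ≤ z.re := by
    have := (Complex.abs_re_le_norm _).trans hz
    rw [abs_le] at this
    simp at this
    norm_num at this ⊢
    linarith
  have h4 : 0 < z.re := by norm_num at h3 ⊢; linarith
  calc ‖zf z‖ ≤ ‖z‖ * (1 + ‖z - 1‖ / z.re) := zf_norm_le h4
    _ ≤ 3.07 * 10 ^ 10 * (1 + 3.07 * 10 ^ 10 / 0.1) := by gcongr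
    _ ≤ _ := by norm_num

lemma zf_center2 (t : ℝ) : 1 / 2 ≤ ‖zf (⟨2, t⟩ : ℂ)‖ := by
  have := zf_center_lb (c := ⟨2, t⟩) (by norm_num)
  have h : 1 ≤ ‖(⟨2, t⟩ - 1 : ℂ)‖ := by
    have := Complex.abs_re_le_norm (⟨2, t⟩ - 1 : ℂ)
    simp at this
    norm_num at this
    exact this
  norm_num at this
  linarith

lemma zf_log_bound {t : ℝ} (ht : |t| ≤ 30610047000) {z : ℂ}
    (hz : z ∈ Metric.closedBall (⟨2, t⟩ : ℂ) 1.9) :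
    Real.log ‖zf z‖ - Real.log ‖zf (⟨2, t⟩ : ℂ)‖ ≤ 52 := by
  have hc := zf_center2 t
  have h1 : Real.log ‖zf z‖ ≤ Real.log (10 ^ 22) := by
    rcases eq_or_lt_of_le (norm_nonneg (zf z)) with h0 | h0
    · rw [← h0, Real.log_zero]; exact Real.log_nonneg (by norm_num)
    · exact Real.log_le_log h0 (zf_bound_ball ht hz)
  have h2 : Real.log (1 / 2) ≤ Real.log ‖zf (⟨2, t⟩ : ℂ)‖ := Real.log_le_log (by norm_num) hc
  have h3 : Real.log (10 ^ 22) - Real.log (1/2) ≤ 52 := by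
    rw [← Real.log_div (by norm_num) (by norm_num), Real.log_le_iff_le_exp (by norm_num)]
    refine le_trans ?_ (by exact_mod_cast exp_nat_lb 52)
    norm_num
  exact le_trans (sub_le_sub h1 h2) h3

lemma crude_count {t : ℝ} (ht : |t| ≤ 30610047000) (Z : Finset ℂ)
    (hZ : ∀ ρ ∈ Z, ρ ∈ Metric.closedBall (⟨2, t⟩ : ℂ) 1.8) : ∑ ρ ∈ Z, (mu ρ : ℝ) ≤ 1000 := by
  have hc : zf (⟨2, t⟩ : ℂ) ≠ 0 := zf_ne_zero_of_re (by norm_num)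
  -- only the genuine zeros contribute
  have hj := jensen (c := ⟨2, t⟩) (R := 1.9) (by norm_num) hc Z (fun ρ hρ =>
    Metric.closedBall_subset_closedBall (by norm_num) (hZ ρ hρ))
  have havg : circleAverage (fun z => Real.log ‖zf z‖) (⟨2, t⟩ : ℂ) 1.9 ≤
      52 + Real.log ‖zf (⟨2, t⟩ : ℂ)‖ := by
    apply circleAverage_mono_on_of_le_circle (zf_circleInt _ _)
    intro z hz
    rw [abs_of_pos (by norm_num)] at hz
    have := zf_log_bound ht (Metric.sphere_subset_closedBall hz)
    linarith
  have hlow : ∑ ρ ∈ Z, (mu ρ : ℝ) * (1 / 19) ≤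
      ∑ ρ ∈ Z, (mu ρ : ℝ) * Real.log (1.9 / ‖ρ - ⟨2, t⟩‖) := by
    apply Finset.sum_le_sum
    intro ρ hρ
    have h1 := hZ ρ hρ
    rw [Metric.mem_closedBall, dist_eq_norm] at h1
    by_cases h0 : ρ = ⟨2, t⟩
    · have : mu ρ = 0 := by
        have : analyticOrderAt zf ρ = 0 :=
          ((zf_differentiable.analyticAt ρ).analyticOrderAt_eq_zero).2 (h0 ▸ hc)
        simp [mu, analyticOrderNatAt, this]
      simp [this]
    · have hp : 0 < ‖ρ - ⟨2, t⟩‖ := norm_pos_iff.2 (sub_ne_zero.2 h0)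
      gcongr
      calc (1/19 : ℝ) ≤ Real.log (1.9/1.8) := by
            have := Real.one_sub_inv_le_log_of_pos (x := 1.9/1.8) (by norm_num)
            norm_num at this ⊢
            exact this
        _ ≤ _ := by
            apply Real.log_le_log (by norm_num)
            gcongr
  rw [← Finset.sum_mul] at hlow
  linarith

/-- centers for the sharp count. -/
noncomputable def ctr (ε : ℝ) (n : ℕ) : ℂ := ⟨3 / 2, ε * n⟩

lemma sharp_count {ε : ℝ} (hε : |ε| = 1) {n : ℕ} (h1 : 6900000000 ≤ n) (h2 : n ≤ 30610047000)
    (Z : Finset ℂ) (hZ : ∀ ρ ∈ Z, ρ ∈ Metric.closedBall (ctr ε n) 1.48) :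
    ∑ ρ ∈ Z, (mu ρ : ℝ) * Real.log (1.48 / ‖ρ - ctr ε n‖) ≤ 16 := by
  have h1' : (6900000000:ℝ) ≤ n := by exact_mod_cast h1
  have h2' : (n:ℝ) ≤ 30610047000 := by exact_mod_cast h2
  have him : |ε * n| = n := by rw [abs_mul, hε, one_mul, abs_of_nonneg (by positivity)]
  have hcre : (ctr ε n).re = 3 / 2 := rfl
  have hcim : (ctr ε n).im = ε * n := rfl
  have hc : zf (ctr ε n) ≠ 0 := zf_ne_zero_of_re (by rw [hcre]; norm_num)
  have hj := jensen (c := ctr ε n) (R := 1.48) (by norm_num) hc Z hZ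
  set X : ℝ := n + 3 with hX
  have hc1 : ‖ctr ε n - 1‖ ≤ 1 / 2 + n := by
    refine (Complex.norm_le_abs_re_add_abs_im _).trans ?_
    rw [Complex.sub_re, Complex.sub_im, hcre, hcim, Complex.one_re, Complex.one_im, sub_zero, him]
    norm_num [abs_of_pos]
  have hc1' : (n:ℝ) ≤ ‖ctr ε n - 1‖ := by
    refine le_trans ?_ (Complex.abs_im_le_norm _)
    rw [Complex.sub_im, hcim, Complex.one_im, sub_zero, him]
  have hlb : (n:ℝ) / 3 ≤ ‖zf (ctr ε n)‖ := by
    have := zf_center_lb (c := ctr ε n) (by rw [hcre]; norm_num)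
    rw [hcre] at this
    norm_num at this
    linarith
  have hz1 : ∀ z ∈ Metric.sphere (ctr ε n) 1.48, ‖z - 1‖ ≤ X - 1 := by
    intro z hz
    rw [mem_sphere_iff_norm] at hz
    calc ‖z - 1‖ = ‖(z - ctr ε n) + (ctr ε n - 1)‖ := by ring_nf
      _ ≤ ‖z - ctr ε n‖ + ‖ctr ε n - 1‖ := norm_add_le _ _
      _ ≤ _ := by rw [hz]; norm_num at hc1 ⊢; linarith
  have havg := avg_half (c := ctr ε n) (R := 1.48) (by norm_num)
    (zf_circleInt (ctr ε n) 1.48) (B1 := Real.log (3 * X)) (B2 := Real.log (50 * X ^ 2)) (by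
      intro z hz hre
      rw [hcre] at hre
      have hne : z ≠ 1 := by rintro rfl; norm_num at hre
      have hpos : 0 < ‖zf z‖ := norm_pos_iff.2 (zf_ne_zero_of_re (by linarith))
      apply Real.log_le_log hpos
      have hzz := zeta_norm_le (s := z) (by linarith)
      have : z.re / (z.re - 1) ≤ 3 := by
        rw [div_le_iff₀ (by linarith)]; linarith
      rw [zf_of_ne hne, norm_mul, mul_comm]
      have := hz1 z hz
      gcongr
      · linarith
      · linarith) (by
      intro z hz _
      have hzz := hz1 z hz
      have hre : 0.02 ≤ z.re := by
        rw [mem_sphere_iff_norm] at hz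
        have := (Complex.abs_re_le_norm _).trans hz.le
        rw [abs_le, Complex.sub_re, hcre] at this
        norm_num at this ⊢
        linarith
      have hre0 : 0 < z.re := by norm_num at hre; linarith
      have hb : ‖zf z‖ ≤ 50 * X ^ 2 := by
        have hzX : ‖z‖ ≤ X := by
          calc ‖z‖ = ‖(z - 1) + 1‖ := by ring_nf
            _ ≤ ‖z - 1‖ + ‖(1:ℂ)‖ := norm_add_le _ _
            _ ≤ _ := by rw [norm_one]; linarith
        calc ‖zf z‖ ≤ ‖z‖ * (1 + ‖z - 1‖ / z.re) := zf_norm_le hre0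
          _ ≤ X * (1 + (X - 1) / 0.02) := by
            gcongr
            linarith
          _ ≤ 50 * X ^ 2 := by norm_num; nlinarith
      rcases eq_or_lt_of_le (norm_nonneg (zf z)) with h0 | h0
      · rw [← h0, Real.log_zero]; exact Real.log_nonneg (by nlinarith)
      · exact Real.log_le_log h0 hb)
  have hl2 : Real.log (n / 3) ≤ Real.log ‖zf (ctr ε n)‖ := Real.log_le_log (by positivity) hlb
  have hnum : (Real.log (3 * X) + Real.log (50 * X ^ 2)) - 2 * Real.log (n / 3) ≤ 32 := by
    have hX0 : 0 < X := by positivity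
    have hn0 : (0:ℝ) < n := by linarith
    have : 2 * Real.log ((n:ℝ) / 3) = Real.log (((n:ℝ) / 3) ^ 2) := by
      rw [Real.log_pow]; norm_num
    rw [this, ← Real.log_mul (by positivity) (by positivity),
      ← Real.log_div (by positivity) (by positivity), Real.log_le_iff_le_exp (by positivity)]
    have h32 : (2.718281828 : ℝ) ^ 32 ≤ Real.exp 32 := by exact_mod_cast exp_nat_lb 32
    refine le_trans ?_ h32
    rw [div_le_iff₀ (by positivity)]
    have hX1 : X ≤ 1.001 * n := by rw [hX]; norm_num; linarith
    calc 3 * X * (50 * X ^ 2) = 150 * X * X ^ 2 := by ring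
      _ ≤ 150 * ((1.001:ℝ) * 30610047000) * ((1.001:ℝ) * (n:ℝ)) ^ 2 := by
        gcongr
        linarith
      _ ≤ _ := by
        rw [mul_pow, div_pow]
        have : 0 < (n:ℝ)^2 := by positivity
        norm_num
        nlinarith
  linarith

lemma norm_sub_ctr {ε : ℝ} (hε : ε * ε = 1) {ρ : ℂ} (hρ : ρ.re = 1 / 2) (k : ℕ) :
    ‖ρ - ctr ε k‖ ^ 2 = 1 + (ε * ρ.im - k) ^ 2 := by
  rw [Complex.sq_norm, Complex.normSq_apply, Complex.sub_re, Complex.sub_im, hρ]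
  simp only [ctr]
  linear_combination (-(ρ.im)^2 + (k:ℝ)^2) * hε

lemma log_half {d : ℝ} (hd : 0 < d) :
    Real.log (1.48 / d) = (1 / 2) * (Real.log (1.48 ^ 2) - Real.log (d ^ 2)) := by
  rw [Real.log_div (by norm_num) hd.ne', Real.log_pow, Real.log_pow]; push_cast; ring

lemma pair_lb {ε : ℝ} (hε : ε * ε = 1) {ρ : ℂ} (hρ : ρ.re = 1 / 2) {n : ℕ}
    (h1 : n ≤ ε * ρ.im) (h2 : ε * ρ.im ≤ n + 1) :
    0.429 ≤ Real.log (1.48 / ‖ρ - ctr ε n‖) + Real.log (1.48 / ‖ρ - ctr ε (n + 1)‖) := by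
  have e1 := norm_sub_ctr hε hρ n
  have e2 := norm_sub_ctr hε hρ (n + 1)
  have p : ∀ k, 0 < ‖ρ - ctr ε k‖ := by
    intro k
    have := norm_sub_ctr hε hρ k
    have h : 0 < ‖ρ - ctr ε k‖ ^ 2 := by rw [this]; positivity
    by_contra h0
    have h1 : ‖ρ - ctr ε k‖ = 0 := le_antisymm (not_lt.1 h0) (norm_nonneg _)
    rw [h1] at h; norm_num at h
  rw [log_half (p n), log_half (p (n+1)), e1, e2]
  push_cast
  set v := ε * ρ.im - n with hv
  have hv' : ε * ρ.im - (n + 1) = v - 1 := by rw [hv]; ring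
  rw [hv']
  have hv0 : 0 ≤ v := by rw [hv]; linarith
  have hv1 : v ≤ 1 := by rw [hv]; linarith
  have h3 : Real.log (1 + v ^ 2) + Real.log (1 + (v - 1) ^ 2) ≤ Real.log 2 := by
    rw [← Real.log_mul (by positivity) (by positivity)]
    apply Real.log_le_log (by positivity)
    nlinarith [mul_nonneg hv0 (sub_nonneg.2 hv1), mul_nonneg (mul_nonneg hv0 (sub_nonneg.2 hv1)) (mul_nonneg hv0 (sub_nonneg.2 hv1))]
  have h4 : 0.858 + Real.log 2 ≤ Real.log (1.48 ^ 2) + Real.log (1.48 ^ 2) := by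
    rw [← Real.log_mul (by norm_num) (by norm_num)]
    have : (1.48 ^ 2 * 1.48 ^ 2 : ℝ) = 2 * 2 * (1.48 ^ 4 / 4) := by norm_num
    rw [this, Real.log_mul (by norm_num) (by norm_num), Real.log_mul (by norm_num) (by norm_num)]
    have := Real.one_sub_inv_le_log_of_pos (x := 1.48 ^ 4 / 4) (by norm_num)
    have := Real.log_two_gt_d9
    norm_num at *
    linarith
  norm_num at *
  linarith

end ZB

namespace ZB
open MeasureTheory Filter
open scoped Topology

lemma geom_bound {a : ℝ} (ha : 0 < a) (N M : ℕ) :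
    ∑ k ∈ Finset.Icc N M, Real.exp (-a * ((k:ℝ) - 1 - N)) ≤ Real.exp a * (1 + 1 / a) := by
  set q := Real.exp (-a) with hq
  have hq1 : q < 1 := by rw [hq, ← Real.exp_zero]; exact Real.exp_lt_exp.2 (by linarith)
  have hq0 : 0 < q := Real.exp_pos _
  have e1 : ∑ k ∈ Finset.Icc N M, Real.exp (-a * ((k:ℝ) - 1 - N)) =
      Real.exp a * ∑ k ∈ Finset.Icc N M, q ^ (k - N) := by
    rw [Finset.mul_sum]
    apply Finset.sum_congr rfl
    intro k hk
    rw [hq, ← Real.exp_nat_mul, ← Real.exp_add, Nat.cast_sub (Finset.mem_Icc.1 hk).1]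
    congr 1; ring
  rw [e1]
  gcongr
  have e2 : ∑ k ∈ Finset.Icc N M, q ^ (k - N) = ∑ j ∈ Finset.range (M + 1 - N), q ^ j := by
    rw [← Finset.Ico_add_one_right_eq_Icc, Finset.sum_Ico_eq_sum_range]
    apply Finset.sum_congr rfl
    intro j _; congr 1; omega
  rw [e2]
  have e3 : ∑ j ∈ Finset.range (M + 1 - N), q ^ j ≤ (1 - q)⁻¹ := by
    rw [← tsum_geometric_of_lt_one hq0.le hq1]
    exact (summable_geometric_of_lt_one hq0.le hq1).sum_le_tsum _ (fun _ _ => by positivity)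
  refine e3.trans ?_
  have h4 : q ≤ 1 / (1 + a) := by
    rw [hq, Real.exp_neg, ← one_div]
    apply one_div_le_one_div_of_le (by linarith)
    linarith [Real.add_one_le_exp a]
  have h5 : a / (1 + a) ≤ 1 - q := by
    have : a / (1 + a) = 1 - 1 / (1 + a) := by field_simp; ring
    linarith
  calc (1 - q)⁻¹ ≤ (a / (1 + a))⁻¹ := by
        apply inv_anti₀ (by positivity) h5
    _ = _ := by field_simp; ring

lemma tail_count {ε : ℝ} (hε : ε = 1 ∨ ε = -1) {a : ℝ} (ha : 0 < a) (N : ℕ) (hN : 6900000000 ≤ N)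
    (Z : Finset ℂ) (hre : ∀ ρ ∈ Z, ρ.re = 1 / 2) (h1 : ∀ ρ ∈ Z, (N:ℝ) ≤ ε * ρ.im)
    (h2 : ∀ ρ ∈ Z, ε * ρ.im ≤ 30610046000) :
    ∑ ρ ∈ Z, (mu ρ : ℝ) * Real.exp (-a * (ε * ρ.im - N)) ≤
      16 / 0.429 * (Real.exp a * (1 + 1 / a)) := by
  have hεε : ε * ε = 1 := by rcases hε with rfl | rfl <;> norm_num
  have hεa : |ε| = 1 := by rcases hε with rfl | rfl <;> norm_num
  set I := Finset.Icc N 30610046001 with hI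
  -- the pairing function
  set F : ℂ → ℕ → ℝ := fun ρ k => if |ε * ρ.im - k| ≤ 1 then
    Real.exp (-a * ((k:ℝ) - 1 - N)) * Real.log (1.48 / ‖ρ - ctr ε k‖) else 0 with hF
  have hball : ∀ ρ ∈ Z, ∀ k : ℕ, |ε * ρ.im - k| ≤ 1 → ‖ρ - ctr ε k‖ ≤ 1.48 := by
    intro ρ hρ k hk
    have e := norm_sub_ctr hεε (hre ρ hρ) k
    have : (ε * ρ.im - k) ^ 2 ≤ 1 := by
      rw [← sq_abs]; have := abs_nonneg (ε * ρ.im - k); nlinarith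
    have h0 : ‖ρ - ctr ε k‖ ^ 2 ≤ 1.48 ^ 2 := by rw [e]; norm_num; linarith
    exact (pow_le_pow_iff_left₀ (norm_nonneg _) (by norm_num) two_ne_zero).1 h0
  have hpos : ∀ ρ ∈ Z, ∀ k : ℕ, 0 < ‖ρ - ctr ε k‖ := by
    intro ρ hρ k
    have e := norm_sub_ctr hεε (hre ρ hρ) k
    rcases eq_or_lt_of_le (norm_nonneg (ρ - ctr ε k)) with h | h
    · rw [← h] at e; nlinarith [sq_nonneg (ε * ρ.im - k)]
    · exact h
  have hlog : ∀ ρ ∈ Z, ∀ k : ℕ, |ε * ρ.im - k| ≤ 1 → 0 ≤ Real.log (1.48 / ‖ρ - ctr ε k‖) := by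
    intro ρ hρ k hk
    apply Real.log_nonneg
    rw [le_div_iff₀ (hpos ρ hρ k), one_mul]
    exact hball ρ hρ k hk
  have hFnn : ∀ ρ ∈ Z, ∀ k : ℕ, 0 ≤ F ρ k := by
    intro ρ hρ k
    simp only [hF]
    split_ifs with h
    · exact mul_nonneg (Real.exp_pos _).le (hlog ρ hρ k h)
    · exact le_refl _
  have hpt : ∀ ρ ∈ Z, 0.429 * Real.exp (-a * (ε * ρ.im - N)) ≤ ∑ k ∈ I, F ρ k := by
    intro ρ hρ
    set y := ε * ρ.im with hy
    have hy1 := h1 ρ hρ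
    have hy2 := h2 ρ hρ
    have hy0 : 0 ≤ y := le_trans (by positivity) hy1
    set n := ⌊y⌋₊ with hn
    have hn1 : (n:ℝ) ≤ y := Nat.floor_le hy0
    have hn2 : y < n + 1 := Nat.lt_floor_add_one y
    have hnN : N ≤ n := Nat.le_floor hy1
    have hnM : n ≤ 30610046000 := by
      have : (n:ℝ) ≤ 30610046000 := hn1.trans hy2
      exact_mod_cast this
    have hp := pair_lb hεε (hre ρ hρ) (n := n) hn1 hn2.le
    have hsub : ({n, n+1} : Finset ℕ) ⊆ I := by
      intro k hk
      simp only [Finset.mem_insert, Finset.mem_singleton] at hk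
      rw [hI, Finset.mem_Icc]
      rcases hk with rfl | rfl <;> constructor <;> omega
    have a1 : |y - n| ≤ 1 := by rw [abs_le]; constructor <;> linarith
    have a2 : |y - (n+1:ℕ)| ≤ 1 := by push_cast; rw [abs_le]; constructor <;> linarith
    calc 0.429 * Real.exp (-a * (y - N)) ≤ (Real.log (1.48 / ‖ρ - ctr ε n‖) +
          Real.log (1.48 / ‖ρ - ctr ε (n + 1)‖)) * Real.exp (-a * (y - N)) := by gcongr
      _ = Real.exp (-a * (y - N)) * Real.log (1.48 / ‖ρ - ctr ε n‖) +
          Real.exp (-a * (y - N)) * Real.log (1.48 / ‖ρ - ctr ε (n + 1)‖) := by ring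
      _ ≤ F ρ n + F ρ (n + 1) := by
          have b1 := hlog ρ hρ n a1
          have b2 := hlog ρ hρ (n+1) a2
          simp only [hF]
          rw [if_pos a1, if_pos a2]
          apply add_le_add
          · apply mul_le_mul_of_nonneg_right _ b1
            apply Real.exp_le_exp.2
            nlinarith
          · apply mul_le_mul_of_nonneg_right _ b2
            apply Real.exp_le_exp.2
            push_cast
            nlinarith
      _ = ∑ k ∈ ({n, n+1} : Finset ℕ), F ρ k := by
          rw [Finset.sum_pair (by omega)]
      _ ≤ _ := Finset.sum_le_sum_of_subset_of_nonneg hsub (fun k _ _ => hFnn ρ hρ k)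
  have hk : ∀ k ∈ I, ∑ ρ ∈ Z, (mu ρ : ℝ) * F ρ k ≤ 16 * Real.exp (-a * ((k:ℝ) - 1 - N)) := by
    intro k hkI
    rw [hI, Finset.mem_Icc] at hkI
    have hs := sharp_count hεa (n := k) (by omega) (by omega)
      (Z.filter (fun ρ => |ε * ρ.im - k| ≤ 1)) (by
        intro ρ hρ
        rw [Finset.mem_filter] at hρ
        rw [Metric.mem_closedBall, dist_eq_norm]
        exact hball ρ hρ.1 k hρ.2)
    calc ∑ ρ ∈ Z, (mu ρ : ℝ) * F ρ k = Real.exp (-a * ((k:ℝ) - 1 - N)) *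
          ∑ ρ ∈ Z.filter (fun ρ => |ε * ρ.im - k| ≤ 1),
            (mu ρ : ℝ) * Real.log (1.48 / ‖ρ - ctr ε k‖) := by
          rw [Finset.sum_filter, Finset.mul_sum]
          apply Finset.sum_congr rfl
          intro ρ _
          simp only [hF]
          split_ifs <;> ring
      _ ≤ Real.exp (-a * ((k:ℝ) - 1 - N)) * 16 := by gcongr
      _ = _ := mul_comm _ _
  have main : 0.429 * ∑ ρ ∈ Z, (mu ρ : ℝ) * Real.exp (-a * (ε * ρ.im - N)) ≤
      16 * (Real.exp a * (1 + 1 / a)) := by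
    calc 0.429 * ∑ ρ ∈ Z, (mu ρ : ℝ) * Real.exp (-a * (ε * ρ.im - N))
        = ∑ ρ ∈ Z, (mu ρ : ℝ) * (0.429 * Real.exp (-a * (ε * ρ.im - N))) := by
          rw [Finset.mul_sum]; apply Finset.sum_congr rfl; intros; ring
      _ ≤ ∑ ρ ∈ Z, (mu ρ : ℝ) * ∑ k ∈ I, F ρ k := by
          apply Finset.sum_le_sum; intro ρ hρ
          exact mul_le_mul_of_nonneg_left (hpt ρ hρ) (by positivity)
      _ = ∑ k ∈ I, ∑ ρ ∈ Z, (mu ρ : ℝ) * F ρ k := by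
          simp_rw [Finset.mul_sum]; rw [Finset.sum_comm]
      _ ≤ ∑ k ∈ I, 16 * Real.exp (-a * ((k:ℝ) - 1 - N)) := Finset.sum_le_sum hk
      _ = 16 * ∑ k ∈ I, Real.exp (-a * ((k:ℝ) - 1 - N)) := by rw [Finset.mul_sum]
      _ ≤ _ := by gcongr; exact geom_bound ha N _
  rw [div_mul_eq_mul_div, le_div_iff₀ (by norm_num)]
  linarith

/-- The tail of the sum over zeros above height `T`, for one sign of the ordinate. -/
lemma tail_one {ε : ℝ} (hε : ε = 1 ∨ ε = -1) (Z : Finset ℂ) (hre : ∀ ρ ∈ Z, ρ.re = 1 / 2)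
    (h1 : ∀ ρ ∈ Z, 6970346000 ≤ ε * ρ.im) (h2 : ∀ ρ ∈ Z, ε * ρ.im ≤ 30610046000) :
    ∑ ρ ∈ Z, (mu ρ : ℝ) * (Real.exp (-ρ.im ^ 2 / (2 * 1153308722614227968)) / ‖ρ‖) ≤
      0.7 * 10 ^ (-9 : ℤ) := by
  set a : ℝ := 6970346000 / 1153308722614227968 with ha
  have hεε : ε * ε = 1 := by rcases hε with rfl | rfl <;> norm_num
  have ht := tail_count hε (a := a) (by rw [ha]; norm_num) 6970346000 (by norm_num) Z hre
    (by exact_mod_cast h1) h2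
  have hE : Real.exp (-21) ≤ 7.583 * 10 ^ (-10 : ℤ) := by
    have h21 : (2.718281828 : ℝ) ^ 21 ≤ Real.exp 21 := by exact_mod_cast exp_nat_lb 21
    rw [Real.exp_neg]
    calc (Real.exp 21)⁻¹ ≤ ((2.718281828 : ℝ) ^ 21)⁻¹ := inv_anti₀ (by positivity) h21
      _ ≤ _ := by norm_num
  have hpt : ∀ ρ ∈ Z, (mu ρ : ℝ) * (Real.exp (-ρ.im ^ 2 / (2 * 1153308722614227968)) / ‖ρ‖) ≤
      (Real.exp (-21) / 6970346000) * ((mu ρ : ℝ) * Real.exp (-a * (ε * ρ.im - (6970346000:ℕ)))) := by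
    intro ρ hρ
    have e1 : Real.exp (-ρ.im ^ 2 / (2 * 1153308722614227968)) ≤
        Real.exp (-21) * Real.exp (-a * (ε * ρ.im - (6970346000:ℕ))) := by
      rw [← Real.exp_add]
      apply Real.exp_le_exp.2
      have hsq : ρ.im ^ 2 = (ε * ρ.im) ^ 2 := by rw [mul_pow, pow_two ε, hεε, one_mul]
      rw [hsq, ha]
      have := h1 ρ hρ
      push_cast
      nlinarith [sq_nonneg (ε * ρ.im - 6970346000)]
    have e2 : 6970346000 ≤ ‖ρ‖ := by
      have hi := Complex.abs_im_le_norm ρ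
      have : ε * ρ.im ≤ |ρ.im| := by
        rcases hε with rfl | rfl
        · rw [one_mul]; exact le_abs_self _
        · rw [neg_one_mul]; exact neg_le_abs _
      linarith [h1 ρ hρ]
    calc _ ≤ (mu ρ : ℝ) * ((Real.exp (-21) * Real.exp (-a * (ε * ρ.im - (6970346000:ℕ)))) / 6970346000) := by
          gcongr
      _ = _ := by ring
  have ea : Real.exp a ≤ 1.0001 := by
    have h := Real.exp_bound_div_one_sub_of_interval (x := a) (by rw [ha]; norm_num) (by rw [ha]; norm_num)
    refine h.trans ?_
    rw [ha]; norm_num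
  calc _ ≤ ∑ ρ ∈ Z, (Real.exp (-21) / 6970346000) *
        ((mu ρ : ℝ) * Real.exp (-a * (ε * ρ.im - (6970346000:ℕ)))) := Finset.sum_le_sum hpt
    _ = (Real.exp (-21) / 6970346000) * ∑ ρ ∈ Z,
        ((mu ρ : ℝ) * Real.exp (-a * (ε * ρ.im - (6970346000:ℕ)))) := by rw [Finset.mul_sum]
    _ ≤ (7.583 * 10 ^ (-10 : ℤ) / 6970346000) * (16 / 0.429 * (1.0001 * (1 + 1 / a))) := by
        gcongr
        refine ht.trans ?_
        have : 0 < a := by rw [ha]; norm_num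
        gcongr
    _ ≤ _ := by rw [ha]; norm_num

end ZB

namespace ZB
open MeasureTheory Filter
open scoped Topology

lemma logderiv_bound {g : ℂ → ℂ} (hg : Differentiable ℂ g) {c : ℂ}
    (hne : ∀ z ∈ Metric.ball c 1.8, g z ≠ 0) {M : ℝ} (hM0 : 0 < M)
    (hM : ∀ z ∈ Metric.ball c 1.8, ‖g z‖ ≤ Real.exp M * ‖g c‖) {s : ℂ}
    (hs : s ∈ Metric.closedBall c 1.75) : ‖deriv g s / g s‖ ≤ 5680 * M := by
  have hcb : c ∈ Metric.ball c 1.8 := Metric.mem_ball_self (by norm_num)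
  have hdg : Differentiable ℂ (deriv g) := hg.deriv
  have hd : DifferentiableOn ℂ (fun z => deriv g z / g z) (Metric.ball c 1.8) := fun z hz =>
    ((hdg z).div (hg z) (hne z hz)).differentiableWithinAt
  obtain ⟨L, hLc, hL⟩ := hd.isExactOn_ball.with_val_at c 0
  have hconst : ∀ z ∈ Metric.ball c 1.8, g z * Complex.exp (-L z) = g c := by
    intro z hz
    have hd2 : ∀ w ∈ Metric.ball c 1.8, HasDerivAt (fun w => g w * Complex.exp (-L w)) 0 w := by
      intro w hw
      have h1 := (hg w).hasDerivAt.mul (hL w hw).neg.cexp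
      refine h1.congr_deriv ?_
      have := hne w hw
      field_simp
      ring
    have := Metric.isOpen_ball.is_const_of_deriv_eq_zero (f := fun w => g w * Complex.exp (-L w))
      (convex_ball c 1.8).isPreconnected
      (fun w hw => (hd2 w hw).differentiableAt.differentiableWithinAt)
      (fun w hw => (hd2 w hw).deriv) hz hcb
    simpa [hLc] using this
  have hexp : ∀ z ∈ Metric.ball c 1.8, (L z).re ≤ M := by
    intro z hz
    have h1 := hconst z hz
    have h2 : g z = g c * Complex.exp (L z) := by
      rw [← h1, mul_assoc, ← Complex.exp_add]; simp
    have h3 := hM z hz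
    rw [h2, norm_mul, Complex.norm_exp, mul_comm] at h3
    have h4 : 0 < ‖g c‖ := norm_pos_iff.2 (hne c hcb)
    exact Real.exp_le_exp.1 (le_of_mul_le_mul_right h3 h4)
  have hLd : ∀ z ∈ Metric.ball c 1.8, DifferentiableAt ℂ L z := fun z hz =>
    (hL z hz).differentiableAt
  have hBC : ∀ z ∈ Metric.closedBall c 1.775, ‖L z‖ ≤ 142 * M := by
    intro z hz
    rw [Metric.mem_closedBall, dist_eq_norm] at hz
    have hmem : ∀ w ∈ Metric.ball (0:ℂ) 1.8, c + w ∈ Metric.ball c 1.8 := by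
      intro w hw; simpa using hw
    have h := Complex.borelCaratheodory_zero (f := fun w => L (c + w)) (M := M) (R := 1.8)
      (z := z - c) hM0 (fun w hw => by
        have : DifferentiableAt ℂ (fun w => L (c + w)) w :=
          (hLd (c + w) (hmem w hw)).comp w (by fun_prop)
        exact this.differentiableWithinAt) (fun w hw => hexp _ (hmem w hw)) (by norm_num)
      (by rw [mem_ball_zero_iff]; norm_num at hz ⊢; linarith) (by simpa using hLc)
    simp only [add_sub_cancel] at h
    refine h.trans ?_
    have hpos : 0 < 1.8 - ‖z - c‖ := by norm_num at hz ⊢; linarith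
    rw [div_le_iff₀ hpos]
    norm_num at hz ⊢
    nlinarith
  have hsL : deriv L s = deriv g s / g s := (hL s (by
    rw [Metric.mem_closedBall] at hs; rw [Metric.mem_ball]; norm_num at hs ⊢; linarith)).deriv
  rw [← hsL]
  have hsub : Metric.closedBall s 0.025 ⊆ Metric.closedBall c 1.775 := by
    apply Metric.closedBall_subset_closedBall'
    rw [Metric.mem_closedBall] at hs
    norm_num at hs ⊢; linarith
  have hsub2 : Metric.closedBall c 1.775 ⊆ Metric.ball c 1.8 :=
    Metric.closedBall_subset_ball (by norm_num)
  have := Complex.norm_deriv_le_of_forall_mem_sphere_norm_le (f := L) (c := s) (R := 0.025)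
    (C := 142 * M) (by norm_num) (by
      apply DifferentiableOn.diffContOnCl
      rw [closure_ball _ (by norm_num)]
      exact fun z hz => (hLd z (hsub2 (hsub hz))).differentiableWithinAt)
    (fun z hz => hBC z (hsub (Metric.sphere_subset_closedBall hz)))
  refine this.trans (le_of_eq ?_)
  norm_num; ring

lemma zf_logderiv_bound {t : ℝ} (ht : |t| ≤ 30610047000) {s : ℂ}
    (hs : s ∈ Metric.closedBall (⟨2, t⟩ : ℂ) 1.75) {δ : ℝ} (hδ : 0 < δ)
    (hdist : ∀ ρ, zf ρ = 0 → δ ≤ ‖s - ρ‖) :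
    ‖deriv zf s / zf s‖ ≤ 2 * 10 ^ 7 + 1000 / δ := by
  classical
  set c : ℂ := ⟨2, t⟩ with hc
  have hfin := zeros_finite (isCompact_closedBall c 1.8)
  set Z := hfin.toFinset with hZ
  have hZm : ∀ ρ, ρ ∈ Z ↔ ρ ∈ Metric.closedBall c 1.8 ∧ zf ρ = 0 := by
    intro ρ; rw [hZ, Set.Finite.mem_toFinset]; rfl
  obtain ⟨g, hg, hgZ, hfg⟩ := factor zf_differentiable zf_order_ne_top Z
  have hcount := crude_count ht Z (fun ρ hρ => ((hZm ρ).1 hρ).1)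
  have hcne : zf c ≠ 0 := zf_ne_zero_of_re (by simp [hc])
  have hgne : ∀ z ∈ Metric.closedBall c 1.8, g z ≠ 0 := by
    intro z hz h0
    have : zf z = 0 := by rw [hfg, h0, mul_zero]
    exact hgZ z ((hZm z).2 ⟨hz, this⟩) h0
  set P : ℂ → ℂ := fun s => ∏ ρ ∈ Z, (s - ρ) ^ (analyticOrderNatAt zf ρ) with hP
  have hsum18 : (18:ℝ) ^ (∑ ρ ∈ Z, mu ρ) ≤ Real.exp 3000 := by
    have h18 : (18:ℝ) ≤ Real.exp 3 := by
      refine le_trans ?_ (by exact_mod_cast exp_nat_lb 3)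
      norm_num
    have hN : (∑ ρ ∈ Z, mu ρ) ≤ 1000 := by exact_mod_cast hcount
    calc (18:ℝ) ^ (∑ ρ ∈ Z, mu ρ) ≤ 18 ^ 1000 := pow_le_pow_right₀ (by norm_num) hN
      _ ≤ (Real.exp 3) ^ 1000 := by gcongr
      _ = _ := by rw [← Real.exp_nat_mul]; norm_num
  have hPle : ∀ z ∈ Metric.sphere c 1.9, ‖P c‖ ≤ Real.exp 3000 * ‖P z‖ := by
    intro z hz
    rw [mem_sphere_iff_norm] at hz
    calc ‖P c‖ = ∏ ρ ∈ Z, ‖c - ρ‖ ^ mu ρ := by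
          simp only [hP, norm_prod, norm_pow, mu]
      _ ≤ ∏ ρ ∈ Z, (18 * ‖z - ρ‖) ^ mu ρ := by
          apply Finset.prod_le_prod (fun _ _ => by positivity)
          intro ρ hρ
          have h1 := ((hZm ρ).1 hρ).1
          rw [Metric.mem_closedBall, dist_eq_norm] at h1
          have h2 : ‖z - c‖ ≤ ‖z - ρ‖ + ‖ρ - c‖ := by
            calc ‖z - c‖ = ‖(z - ρ) + (ρ - c)‖ := by ring_nf
              _ ≤ _ := norm_add_le _ _
          gcongr
          rw [norm_sub_rev]
          rw [hz] at h2
          norm_num at h1 h2 ⊢; linarith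
      _ = 18 ^ (∑ ρ ∈ Z, mu ρ) * ∏ ρ ∈ Z, ‖z - ρ‖ ^ mu ρ := by
          simp_rw [mul_pow]
          rw [Finset.prod_mul_distrib, Finset.prod_pow_eq_pow_sum]
      _ ≤ Real.exp 3000 * ‖P z‖ := by
          simp only [hP, norm_prod, norm_pow, mu] at hsum18 ⊢
          gcongr
  have hPc : P c ≠ 0 := fun h0 => hcne (by rw [hfg]; simp only [hP] at h0; rw [h0, zero_mul])
  have hsph : ∀ z ∈ Metric.sphere c 1.9, ‖g z‖ ≤ Real.exp 3052 * ‖g c‖ := by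
    intro z hz
    have h1 := hPle z hz
    have hPc0 : 0 < ‖P c‖ := norm_pos_iff.2 hPc
    have hPz0 : 0 < ‖P z‖ := by
      by_contra h
      have : ‖P z‖ = 0 := le_antisymm (not_lt.1 h) (norm_nonneg _)
      rw [this, mul_zero] at h1; linarith
    have h2 : ‖zf z‖ ≤ Real.exp 52 * ‖zf c‖ := by
      have hl := zf_log_bound ht (Metric.sphere_subset_closedBall hz)
      rcases eq_or_lt_of_le (norm_nonneg (zf z)) with h0 | h0
      · rw [← h0]; positivity
      · have hp : 0 < ‖zf c‖ := norm_pos_iff.2 hcne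
        rw [← Real.log_div h0.ne' hp.ne', Real.log_le_iff_le_exp (by positivity),
          div_le_iff₀ hp] at hl
        exact hl
    have e1 : ‖zf z‖ = ‖P z‖ * ‖g z‖ := by rw [hfg z, norm_mul]
    have e2 : ‖zf c‖ = ‖P c‖ * ‖g c‖ := by rw [hfg c, norm_mul]
    rw [e1, e2] at h2
    have h3 : ‖P z‖ * ‖g z‖ ≤ ‖P z‖ * (Real.exp 3052 * ‖g c‖) := by
      calc ‖P z‖ * ‖g z‖ ≤ Real.exp 52 * (‖P c‖ * ‖g c‖) := h2
        _ ≤ Real.exp 52 * ((Real.exp 3000 * ‖P z‖) * ‖g c‖) := by gcongr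
        _ = ‖P z‖ * ((Real.exp 52 * Real.exp 3000) * ‖g c‖) := by ring
        _ = _ := by rw [← Real.exp_add]; norm_num
    exact le_of_mul_le_mul_left h3 hPz0
  have hball : ∀ z ∈ Metric.ball c 1.8, ‖g z‖ ≤ Real.exp 3052 * ‖g c‖ := by
    intro z hz
    refine Complex.norm_le_of_forall_mem_frontier_norm_le (U := Metric.ball c 1.9)
      Metric.isBounded_ball hg.diffContOnCl ?_ (subset_closure (Metric.ball_subset_ball (by norm_num) hz))
    intro w hw
    rw [frontier_ball _ (by norm_num)] at hw
    exact hsph w hw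
  have hgl := logderiv_bound hg (fun z hz => hgne z (Metric.ball_subset_closedBall hz))
    (by norm_num : (0:ℝ) < 3052) hball hs
  have hs0 : ∀ ρ ∈ Z, s - ρ ≠ 0 := by
    intro ρ hρ h0
    have := hdist ρ ((hZm ρ).1 hρ).2
    rw [h0, norm_zero] at this; linarith
  have hPs : P s ≠ 0 := by
    simp only [hP]
    exact Finset.prod_ne_zero_iff.2 (fun ρ hρ => pow_ne_zero _ (hs0 ρ hρ))
  have hgs : g s ≠ 0 := hgne s (Metric.closedBall_subset_closedBall (by norm_num) hs)
  have hPd : Differentiable ℂ P := by simp only [hP]; fun_prop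
  have hld : deriv zf s / zf s = (∑ ρ ∈ Z, (mu ρ : ℂ) / (s - ρ)) + deriv g s / g s := by
    have e : zf = fun z => P z * g z := by ext z; exact hfg z
    have h1 := logDeriv_mul (f := P) (g := g) s hPs hgs (hPd s) (hg s)
    rw [← e] at h1
    rw [logDeriv_apply, logDeriv_apply (f := g)] at h1
    rw [h1]
    congr 1
    simp only [hP]
    rw [logDeriv_prod (f := fun (ρ : ℂ) (z : ℂ) => (z - ρ) ^ (analyticOrderNatAt zf ρ)) (x := s)
      (fun ρ hρ => pow_ne_zero _ (hs0 ρ hρ)) (fun ρ _ => by fun_prop)]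
    apply Finset.sum_congr rfl
    intro ρ hρ
    rw [logDeriv_fun_pow (by fun_prop)]
    simp [logDeriv_apply, mu, div_eq_mul_inv]
  rw [hld]
  refine (norm_add_le _ _).trans ?_
  have hS : ‖∑ ρ ∈ Z, (mu ρ : ℂ) / (s - ρ)‖ ≤ 1000 / δ := by
    calc _ ≤ ∑ ρ ∈ Z, (mu ρ : ℝ) / δ := by
          refine norm_sum_le_of_le _ (fun ρ hρ => ?_)
          rw [norm_div, Complex.norm_natCast]
          have := hdist ρ ((hZm ρ).1 hρ).2
          gcongr
      _ = (∑ ρ ∈ Z, (mu ρ : ℝ)) / δ := by rw [Finset.sum_div]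
      _ ≤ _ := by gcongr
  norm_num at hgl ⊢
  linarith

end ZB

namespace ZB
open MeasureTheory Filter
open scoped Topology

/-- Boundary integral over a rectangle, counterclockwise. -/
noncomputable def bd (F : ℂ → ℂ) (x0 x1 y0 y1 : ℝ) : ℂ :=
  (∫ x in x0..x1, F (x + y0 * Complex.I)) - (∫ x in x0..x1, F (x + y1 * Complex.I)) +
    Complex.I * (∫ y in y0..y1, F (x1 + y * Complex.I)) -
    Complex.I * (∫ y in y0..y1, F (x0 + y * Complex.I))

/-- closed rectangle -/
def rect (x0 x1 y0 y1 : ℝ) : Set ℂ := {z | (x0 ≤ z.re ∧ z.re ≤ x1) ∧ (y0 ≤ z.im ∧ z.im ≤ y1)}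

/-- boundary of the rectangle -/
def bdry (x0 x1 y0 y1 : ℝ) : Set ℂ :=
  {z | z ∈ rect x0 x1 y0 y1 ∧ (z.re = x0 ∨ z.re = x1 ∨ z.im = y0 ∨ z.im = y1)}

structure BdInt (F : ℂ → ℂ) (x0 x1 y0 y1 : ℝ) : Prop where
  h1 : IntervalIntegrable (fun x : ℝ => F (x + y0 * Complex.I)) volume x0 x1
  h2 : IntervalIntegrable (fun x : ℝ => F (x + y1 * Complex.I)) volume x0 x1
  h3 : IntervalIntegrable (fun y : ℝ => F (x1 + y * Complex.I)) volume y0 y1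
  h4 : IntervalIntegrable (fun y : ℝ => F (x0 + y * Complex.I)) volume y0 y1

variable {x0 x1 y0 y1 : ℝ}

lemma BdInt.of_cont (hx : x0 < x1) (hy : y0 < y1) {F : ℂ → ℂ}
    (hF : ContinuousOn F (bdry x0 x1 y0 y1)) : BdInt F x0 x1 y0 y1 := by
  constructor
  · apply ContinuousOn.intervalIntegrable
    rw [Set.uIcc_of_le hx.le]
    refine hF.comp (by fun_prop) (fun x hx' => ?_)
    simp only [bdry, rect, Set.mem_ofPred_eq]; simp [hx'.1, hx'.2, hy.le]
  · apply ContinuousOn.intervalIntegrable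
    rw [Set.uIcc_of_le hx.le]
    refine hF.comp (by fun_prop) (fun x hx' => ?_)
    simp only [bdry, rect, Set.mem_ofPred_eq]; simp [hx'.1, hx'.2, hy.le]
  · apply ContinuousOn.intervalIntegrable
    rw [Set.uIcc_of_le hy.le]
    refine hF.comp (by fun_prop) (fun x hx' => ?_)
    simp only [bdry, rect, Set.mem_ofPred_eq]; simp [hx'.1, hx'.2, hx.le]
  · apply ContinuousOn.intervalIntegrable
    rw [Set.uIcc_of_le hy.le]
    refine hF.comp (by fun_prop) (fun x hx' => ?_)
    simp only [bdry, rect, Set.mem_ofPred_eq]; simp [hx'.1, hx'.2, hx.le]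

lemma bd_add {F G : ℂ → ℂ} (hF : BdInt F x0 x1 y0 y1) (hG : BdInt G x0 x1 y0 y1) :
    bd (fun z => F z + G z) x0 x1 y0 y1 = bd F x0 x1 y0 y1 + bd G x0 x1 y0 y1 := by
  unfold bd
  rw [intervalIntegral.integral_add hF.h1 hG.h1, intervalIntegral.integral_add hF.h2 hG.h2,
    intervalIntegral.integral_add hF.h3 hG.h3, intervalIntegral.integral_add hF.h4 hG.h4]
  ring

lemma bd_const_mul {F : ℂ → ℂ} (a : ℂ) :
    bd (fun z => a * F z) x0 x1 y0 y1 = a * bd F x0 x1 y0 y1 := by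
  unfold bd
  simp only [intervalIntegral.integral_const_mul]
  ring

lemma BdInt.add {F G : ℂ → ℂ} (hF : BdInt F x0 x1 y0 y1) (hG : BdInt G x0 x1 y0 y1) :
    BdInt (fun z => F z + G z) x0 x1 y0 y1 :=
  ⟨hF.h1.add hG.h1, hF.h2.add hG.h2, hF.h3.add hG.h3, hF.h4.add hG.h4⟩

lemma BdInt.const_mul {F : ℂ → ℂ} (a : ℂ) (hF : BdInt F x0 x1 y0 y1) :
    BdInt (fun z => a * F z) x0 x1 y0 y1 :=
  ⟨hF.h1.const_mul a, hF.h2.const_mul a, hF.h3.const_mul a, hF.h4.const_mul a⟩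

lemma bd_sum {ι : Type*} (Z : Finset ι) {F : ι → ℂ → ℂ}
    (hF : ∀ i ∈ Z, BdInt (F i) x0 x1 y0 y1) :
    BdInt (fun z => ∑ i ∈ Z, F i z) x0 x1 y0 y1 ∧
    bd (fun z => ∑ i ∈ Z, F i z) x0 x1 y0 y1 = ∑ i ∈ Z, bd (F i) x0 x1 y0 y1 := by
  classical
  induction Z using Finset.induction_on with
  | empty =>
    refine ⟨⟨?_, ?_, ?_, ?_⟩, ?_⟩ <;> simp [bd]
  | insert a Z ha ih =>
    have ih' := ih (fun i hi => hF i (Finset.mem_insert_of_mem hi))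
    have ha' := hF a (Finset.mem_insert_self a Z)
    simp only [Finset.sum_insert ha]
    exact ⟨ha'.add ih'.1, by rw [bd_add ha' ih'.1, ih'.2]⟩

lemma bd_congr (hx : x0 < x1) (hy : y0 < y1) {F G : ℂ → ℂ}
    (h : ∀ z ∈ bdry x0 x1 y0 y1, F z = G z) : bd F x0 x1 y0 y1 = bd G x0 x1 y0 y1 := by
  have e1 : (∫ x in x0..x1, F ((x:ℝ) + y0 * Complex.I)) = ∫ x in x0..x1, G ((x:ℝ) + y0 * Complex.I) := by
    apply intervalIntegral.integral_congr
    intro x hx'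
    rw [Set.uIcc_of_le hx.le] at hx'
    show F _ = G _
    apply h
    simp only [bdry, rect, Set.mem_ofPred_eq]; simp [hx'.1, hx'.2, hy.le]
  have e2 : (∫ x in x0..x1, F ((x:ℝ) + y1 * Complex.I)) = ∫ x in x0..x1, G ((x:ℝ) + y1 * Complex.I) := by
    apply intervalIntegral.integral_congr
    intro x hx'
    rw [Set.uIcc_of_le hx.le] at hx'
    show F _ = G _
    apply h
    simp only [bdry, rect, Set.mem_ofPred_eq]; simp [hx'.1, hx'.2, hy.le]
  have e3 : (∫ x in y0..y1, F (x1 + (x:ℝ) * Complex.I)) = ∫ x in y0..y1, G (x1 + (x:ℝ) * Complex.I) := by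
    apply intervalIntegral.integral_congr
    intro x hx'
    rw [Set.uIcc_of_le hy.le] at hx'
    show F _ = G _
    apply h
    simp only [bdry, rect, Set.mem_ofPred_eq]; simp [hx'.1, hx'.2, hx.le]
  have e4 : (∫ x in y0..y1, F (x0 + (x:ℝ) * Complex.I)) = ∫ x in y0..y1, G (x0 + (x:ℝ) * Complex.I) := by
    apply intervalIntegral.integral_congr
    intro x hx'
    rw [Set.uIcc_of_le hy.le] at hx'
    show F _ = G _
    apply h
    simp only [bdry, rect, Set.mem_ofPred_eq]; simp [hx'.1, hx'.2, hx.le]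
  unfold bd
  rw [e1, e2, e3, e4]

lemma bd_zero (hx : x0 < x1) (hy : y0 < y1) {F : ℂ → ℂ}
    (hF : DifferentiableOn ℂ F (rect x0 x1 y0 y1)) : bd F x0 x1 y0 y1 = 0 := by
  have := Complex.integral_boundary_rect_eq_zero_of_differentiableOn F ⟨x0, y0⟩ ⟨x1, y1⟩ (by
    refine hF.mono ?_
    intro z hz
    rw [Complex.mem_reProdIm] at hz
    simp only [Set.uIcc_of_le hx.le, Set.uIcc_of_le hy.le] at hz
    exact hz)
  simpa [bd] using this

lemma horiz_int {a b y : ℝ} (hy : y ≠ 0) :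
    ∫ x in a..b, 1 / ((x:ℂ) + y * Complex.I) =
      Complex.log (b + y * Complex.I) - Complex.log (a + y * Complex.I) := by
  have hs : ∀ x : ℝ, (x:ℂ) + y * Complex.I ∈ Complex.slitPlane := by
    intro x; rw [Complex.mem_slitPlane_iff]; right; simpa using hy
  have hd : ∀ x ∈ Set.uIcc a b, HasDerivAt (fun x : ℝ => Complex.log ((x:ℂ) + y * Complex.I))
      (1 / ((x:ℂ) + y * Complex.I)) x := by
    intro x _
    refine HasDerivAt.clog_real ?_ (hs x)
    have : HasDerivAt (fun x : ℝ => (x : ℂ)) 1 x := Complex.ofRealCLM.hasDerivAt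
    exact this.add_const _
  rw [intervalIntegral.integral_eq_sub_of_hasDerivAt hd]
  apply ContinuousOn.intervalIntegrable
  intro x _
  refine ContinuousAt.continuousWithinAt ?_
  exact ContinuousAt.div (by fun_prop) (by fun_prop) (Complex.slitPlane_ne_zero (hs x))

lemma vert_int {a b x : ℝ} (hx : 0 < x) :
    Complex.I * ∫ y in a..b, 1 / ((x:ℂ) + y * Complex.I) =
      Complex.log (x + b * Complex.I) - Complex.log (x + a * Complex.I) := by
  have hs : ∀ y : ℝ, (x:ℂ) + y * Complex.I ∈ Complex.slitPlane := by
    intro y; rw [Complex.mem_slitPlane_iff]; left; simpa using hx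
  rw [← intervalIntegral.integral_const_mul]
  have hd : ∀ y ∈ Set.uIcc a b, HasDerivAt (fun y : ℝ => Complex.log ((x:ℂ) + y * Complex.I))
      (Complex.I * (1 / ((x:ℂ) + y * Complex.I))) y := by
    intro y _
    have h2 : HasDerivAt (fun y : ℝ => (x:ℂ) + (y : ℂ) * Complex.I) Complex.I y := by
      have : HasDerivAt (fun y : ℝ => (y : ℂ)) 1 y := Complex.ofRealCLM.hasDerivAt
      simpa using (this.mul_const Complex.I).const_add (x:ℂ)
    have := HasDerivAt.clog_real h2 (hs y)
    rwa [mul_one_div]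
  rw [intervalIntegral.integral_eq_sub_of_hasDerivAt hd]
  apply ContinuousOn.intervalIntegrable
  intro y _
  refine ContinuousAt.continuousWithinAt ?_
  refine ContinuousAt.mul (by fun_prop) ?_
  exact ContinuousAt.div (by fun_prop) (by fun_prop) (Complex.slitPlane_ne_zero (hs y))

lemma vert_int_neg {a b x : ℝ} (hx : x < 0) :
    Complex.I * ∫ y in a..b, 1 / ((x:ℂ) + y * Complex.I) =
      Complex.log (-(x + b * Complex.I)) - Complex.log (-(x + a * Complex.I)) := by
  have h := vert_int (a := -a) (b := -b) (x := -x) (by linarith)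
  have e : ∫ y in a..b, 1 / ((x:ℂ) + y * Complex.I) =
      ∫ y in (-a)..(-b), 1 / (((-x : ℝ):ℂ) + y * Complex.I) := by
    have h5 := intervalIntegral.integral_comp_neg (a := a) (b := b)
      (f := fun y : ℝ => 1 / (((-x : ℝ):ℂ) + y * Complex.I))
    rw [intervalIntegral.integral_symm (-b) (-a), ← h5, ← intervalIntegral.integral_neg]
    apply intervalIntegral.integral_congr
    intro y _
    simp only [Complex.ofReal_neg]
    rw [← one_div_neg_eq_neg_one_div]
    congr 1; ring
  rw [e, h]
  push_cast
  congr 2 <;> ring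

lemma log_sub_up {z : ℂ} (hz : 0 < z.im) : Complex.log z - Complex.log (-z) = π * Complex.I := by
  rw [Complex.log, Complex.log, norm_neg, Complex.arg_neg_eq_arg_sub_pi_of_im_pos hz]
  push_cast; ring

lemma log_sub_dn {z : ℂ} (hz : z.im < 0) : Complex.log z - Complex.log (-z) = -(π * Complex.I) := by
  rw [Complex.log, Complex.log, norm_neg, Complex.arg_neg_eq_arg_add_pi_of_im_neg hz]
  push_cast; ring

lemma bd_inv {ρ : ℂ} (h1 : x0 < ρ.re) (h2 : ρ.re < x1) (h3 : y0 < ρ.im) (h4 : ρ.im < y1) :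
    bd (fun z => 1 / (z - ρ)) x0 x1 y0 y1 = 2 * π * Complex.I := by
  have hρ : ρ = ρ.re + ρ.im * Complex.I := (Complex.re_add_im ρ).symm
  have eH : ∀ y : ℝ, ∫ x in x0..x1, 1 / (((x:ℂ) + y * Complex.I) - ρ) =
      ∫ x in (x0 - ρ.re)..(x1 - ρ.re), 1 / ((x:ℂ) + (y - ρ.im : ℝ) * Complex.I) := by
    intro y
    rw [← intervalIntegral.integral_comp_sub_right]
    congr 1; ext x
    congr 1
    conv_lhs => rw [hρ]
    push_cast; ring
  have eV : ∀ x : ℝ, ∫ y in y0..y1, 1 / (((x:ℂ) + y * Complex.I) - ρ) =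
      ∫ y in (y0 - ρ.im)..(y1 - ρ.im), 1 / (((x - ρ.re : ℝ):ℂ) + y * Complex.I) := by
    intro x
    rw [← intervalIntegral.integral_comp_sub_right]
    congr 1; ext y
    congr 1
    conv_lhs => rw [hρ]
    push_cast; ring
  unfold bd
  rw [eH, eH, eV, eV, horiz_int (by linarith), horiz_int (by linarith), vert_int (by linarith),
    vert_int_neg (by linarith)]
  have a := log_sub_up (z := ((x0 - ρ.re : ℝ):ℂ) + (y1 - ρ.im : ℝ) * Complex.I) (by simp; linarith)
  have b := log_sub_dn (z := ((x0 - ρ.re : ℝ):ℂ) + (y0 - ρ.im : ℝ) * Complex.I) (by simp; linarith)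
  linear_combination a - b

lemma bdry_ne {ρ : ℂ} (h1 : x0 < ρ.re) (h2 : ρ.re < x1) (h3 : y0 < ρ.im) (h4 : ρ.im < y1)
    {z : ℂ} (hz : z ∈ bdry x0 x1 y0 y1) : z - ρ ≠ 0 := by
  intro h
  have : z = ρ := sub_eq_zero.1 h
  subst this
  rcases hz.2 with h | h | h | h <;> linarith

lemma bd_res {ρ : ℂ} (h1 : x0 < ρ.re) (h2 : ρ.re < x1) (h3 : y0 < ρ.im) (h4 : ρ.im < y1)
    {h : ℂ → ℂ} (hh : DifferentiableOn ℂ h (rect x0 x1 y0 y1)) :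
    BdInt (fun z => h z / (z - ρ)) x0 x1 y0 y1 ∧
    bd (fun z => h z / (z - ρ)) x0 x1 y0 y1 = 2 * π * Complex.I * h ρ := by
  have hx : x0 < x1 := h1.trans h2
  have hy : y0 < y1 := h3.trans h4
  have hsub : bdry x0 x1 y0 y1 ⊆ rect x0 x1 y0 y1 := fun z hz => hz.1
  have hnhds : rect x0 x1 y0 y1 ∈ 𝓝 ρ := by
    have : IsOpen {z : ℂ | (x0 < z.re ∧ z.re < x1) ∧ (y0 < z.im ∧ z.im < y1)} := by
      refine IsOpen.inter (IsOpen.inter ?_ ?_) (IsOpen.inter ?_ ?_)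
      · exact isOpen_lt continuous_const Complex.continuous_re
      · exact isOpen_lt Complex.continuous_re continuous_const
      · exact isOpen_lt continuous_const Complex.continuous_im
      · exact isOpen_lt Complex.continuous_im continuous_const
    filter_upwards [this.mem_nhds ⟨⟨h1, h2⟩, ⟨h3, h4⟩⟩] with z hz
    exact ⟨⟨hz.1.1.le, hz.1.2.le⟩, ⟨hz.2.1.le, hz.2.2.le⟩⟩
  have hds := (Complex.differentiableOn_dslope hnhds).2 hh
  have c1 : BdInt (dslope h ρ) x0 x1 y0 y1 :=
    BdInt.of_cont hx hy (hds.continuousOn.mono hsub)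
  have c2 : BdInt (fun z => 1 / (z - ρ)) x0 x1 y0 y1 := by
    apply BdInt.of_cont hx hy
    exact ContinuousOn.div (by fun_prop) (by fun_prop) (fun z hz => bdry_ne h1 h2 h3 h4 hz)
  have c3 : BdInt (fun z => h z / (z - ρ)) x0 x1 y0 y1 := by
    apply BdInt.of_cont hx hy
    exact ContinuousOn.div (hh.continuousOn.mono hsub) (by fun_prop)
      (fun z hz => bdry_ne h1 h2 h3 h4 hz)
  refine ⟨c3, ?_⟩
  have e : bd (fun z => h z / (z - ρ)) x0 x1 y0 y1 =
      bd (fun z => dslope h ρ z + h ρ * (1 / (z - ρ))) x0 x1 y0 y1 := by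
    apply bd_congr hx hy
    intro z hz
    have hne := bdry_ne h1 h2 h3 h4 hz
    rw [dslope_of_ne _ (sub_ne_zero.1 hne), slope_def_field]
    field_simp
    ring
  rw [e, bd_add c1 (c2.const_mul _), bd_zero hx hy hds, bd_const_mul, bd_inv h1 h2 h3 h4]
  ring

lemma bd_logderiv (hx : x0 < x1) (hy : y0 < y1) (Z : Finset ℂ)
    (hZ : ∀ ρ, ρ ∈ Z ↔ ρ ∈ rect x0 x1 y0 y1 ∧ zf ρ = 0)
    (hIntg : ∀ ρ ∈ Z, (x0 < ρ.re ∧ ρ.re < x1) ∧ (y0 < ρ.im ∧ ρ.im < y1))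
    {h : ℂ → ℂ} (hh : DifferentiableOn ℂ h (rect x0 x1 y0 y1)) :
    BdInt (fun z => deriv zf z / zf z * h z) x0 x1 y0 y1 ∧
    bd (fun z => deriv zf z / zf z * h z) x0 x1 y0 y1 =
      2 * π * Complex.I * ∑ ρ ∈ Z, (mu ρ : ℂ) * h ρ := by
  have hsub : bdry x0 x1 y0 y1 ⊆ rect x0 x1 y0 y1 := fun z hz => hz.1
  obtain ⟨g, hg, hgZ, hfg⟩ := factor zf_differentiable zf_order_ne_top Z
  have hgne : ∀ z ∈ rect x0 x1 y0 y1, g z ≠ 0 := by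
    intro z hz h0
    have : zf z = 0 := by rw [hfg, h0, mul_zero]
    exact hgZ z ((hZ z).2 ⟨hz, this⟩) h0
  set P : ℂ → ℂ := fun s => ∏ ρ ∈ Z, (s - ρ) ^ (analyticOrderNatAt zf ρ) with hP
  have hPd : Differentiable ℂ P := by simp only [hP]; fun_prop
  have hld : ∀ s ∈ bdry x0 x1 y0 y1, deriv zf s / zf s * h s =
      deriv g s / g s * h s + (∑ ρ ∈ Z, (mu ρ : ℂ) * (h s / (s - ρ))) := by
    intro s hs
    have hs0 : ∀ ρ ∈ Z, s - ρ ≠ 0 := fun ρ hρ => by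
      obtain ⟨⟨a1, a2⟩, a3, a4⟩ := hIntg ρ hρ
      exact bdry_ne a1 a2 a3 a4 hs
    have hPs : P s ≠ 0 := by
      simp only [hP]
      exact Finset.prod_ne_zero_iff.2 (fun ρ hρ => pow_ne_zero _ (hs0 ρ hρ))
    have e : zf = fun z => P z * g z := by ext z; exact hfg z
    have h1 := logDeriv_mul (f := P) (g := g) s hPs (hgne s (hsub hs)) (hPd s) (hg s)
    rw [← e] at h1
    rw [logDeriv_apply, logDeriv_apply (f := g)] at h1
    rw [h1, add_mul, add_comm]
    congr 1
    simp only [hP]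
    rw [logDeriv_prod (f := fun (ρ : ℂ) (z : ℂ) => (z - ρ) ^ (analyticOrderNatAt zf ρ)) (x := s)
      (fun ρ hρ => pow_ne_zero _ (hs0 ρ hρ)) (fun ρ _ => by fun_prop), Finset.sum_mul]
    apply Finset.sum_congr rfl
    intro ρ hρ
    rw [logDeriv_fun_pow (by fun_prop)]
    simp [logDeriv_apply, mu, div_eq_mul_inv]
    ring
  have d1 : DifferentiableOn ℂ (fun s => deriv g s / g s * h s) (rect x0 x1 y0 y1) :=
    (DifferentiableOn.div hg.deriv.differentiableOn hg.differentiableOn hgne).mul hh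
  have c1 : BdInt (fun s => deriv g s / g s * h s) x0 x1 y0 y1 :=
    BdInt.of_cont hx hy (d1.continuousOn.mono hsub)
  have c2 := bd_sum (x0 := x0) (x1 := x1) (y0 := y0) (y1 := y1) Z
    (F := fun ρ s => (mu ρ : ℂ) * (h s / (s - ρ))) (fun ρ hρ => by
      obtain ⟨⟨a1, a2⟩, a3, a4⟩ := hIntg ρ hρ
      exact (bd_res a1 a2 a3 a4 hh).1.const_mul _)
  constructor
  · apply BdInt.of_cont hx hy
    refine ContinuousOn.mul (ContinuousOn.div zf_differentiable.deriv.continuous.continuousOn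
      zf_differentiable.continuous.continuousOn ?_) (hh.continuousOn.mono hsub)
    intro z hz h0
    obtain ⟨⟨a1, a2⟩, a3, a4⟩ := hIntg z ((hZ z).2 ⟨hz.1, h0⟩)
    exact bdry_ne a1 a2 a3 a4 hz (sub_self z)
  · rw [bd_congr hx hy hld, bd_add c1 c2.1, bd_zero hx hy d1, c2.2, zero_add, Finset.mul_sum]
    apply Finset.sum_congr rfl
    intro ρ hρ
    obtain ⟨⟨a1, a2⟩, a3, a4⟩ := hIntg ρ hρ
    rw [bd_const_mul, (bd_res a1 a2 a3 a4 hh).2]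
    ring

end ZB

namespace ZB
open MeasureTheory Filter
open scoped Topology

/-- finitely many zeros near a given height -/
lemma near_zeros {t : ℝ} (ht : |t| ≤ 30610047000) : ∃ Z : Finset ℂ, Z.card ≤ 1000 ∧
    ∀ ρ, zf ρ = 0 → ρ.re = 1 / 2 → |ρ.im - t| ≤ 0.9 → ρ ∈ Z := by
  have hf := zeros_finite (isCompact_closedBall (⟨2, t⟩ : ℂ) 1.8)
  refine ⟨hf.toFinset, ?_, ?_⟩
  · have hc := crude_count ht hf.toFinset (by
      intro ρ hρ
      have := (hf.mem_toFinset.1 hρ)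
      exact this.1)
    have h2 : (hf.toFinset.card : ℝ) ≤ ∑ ρ ∈ hf.toFinset, (mu ρ : ℝ) := by
      rw [Finset.card_eq_sum_ones]; push_cast
      apply Finset.sum_le_sum
      intro ρ hρ
      have := mu_pos (hf.mem_toFinset.1 hρ).2
      exact_mod_cast this
    have : (hf.toFinset.card : ℝ) ≤ 1000 := le_trans h2 (by exact_mod_cast hc)
    exact_mod_cast this
  · intro ρ h0 hre him
    rw [hf.mem_toFinset]
    refine ⟨?_, h0⟩
    rw [mem_closedBall_iff_norm, ← abs_of_nonneg (norm_nonneg (ρ - _)), ← abs_of_nonneg (show (0:ℝ) ≤ 1.8 by norm_num),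
      ← sq_le_sq, Complex.sq_norm, Complex.normSq_apply]
    simp only [Complex.sub_re, Complex.sub_im, hre]
    have := abs_le.1 him
    nlinarith

lemma exists_H (hRH : ∀ ρ : ℂ, zf ρ = 0 → 0 < ρ.re → |ρ.im| ≤ 30610046000 → ρ.re = 1 / 2) :
    ∃ H : ℝ, 30610045000 ≤ H ∧ H ≤ 30610045999.5 ∧ ∀ ρ : ℂ, zf ρ = 0 → 0 < ρ.re →
      1 / 10000 ≤ |(|ρ.im| - H)| := by
  obtain ⟨Z1, c1, h1⟩ := near_zeros (t := 30610045999.25) (by rw [abs_of_pos] <;> norm_num)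
  obtain ⟨Z2, c2, h2⟩ := near_zeros (t := -30610045999.25) (by rw [abs_neg, abs_of_pos] <;> norm_num)
  by_contra! hcon
  let h : ℕ → ℝ := fun k => 30610045999 + k / 4000
  have hk : ∀ k ∈ Finset.range 2001, ∃ ρ ∈ Z1 ∪ Z2, |(|ρ.im| - h k)| < 1 / 10000 := by
    intro k hk
    have hk' : (k:ℝ) ≤ 2000 := by
      have := Finset.mem_range.1 hk
      exact_mod_cast (by omega : k ≤ 2000)
    have hk0 : (0:ℝ) ≤ k := Nat.cast_nonneg k
    obtain ⟨ρ, h0, hre, hd⟩ := hcon (h k) (by simp only [h]; linarith) (by simp only [h]; linarith)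
    refine ⟨ρ, ?_, hd⟩
    have hd' := abs_lt.1 hd
    simp only [h] at hd'
    have hA : |ρ.im| ≤ 30610046000 := by linarith
    have hhalf := hRH ρ h0 hre hA
    rw [Finset.mem_union]
    rcases le_total 0 ρ.im with hp | hp
    · left; apply h1 ρ h0 hhalf
      rw [abs_of_nonneg hp] at hd'
      rw [abs_le]; constructor <;> linarith
    · right; apply h2 ρ h0 hhalf
      rw [abs_of_nonpos hp] at hd'
      rw [abs_le]; constructor <;> linarith
  choose! f hf hf' using hk
  have hcard : (Z1 ∪ Z2).card < (Finset.range 2001).card := by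
    have := Finset.card_union_le Z1 Z2
    rw [Finset.card_range]; omega
  obtain ⟨x, hx, y, hy, hne, hxy⟩ := Finset.exists_ne_map_eq_of_card_lt_of_maps_to hcard hf
  have e1 := abs_lt.1 (hf' x hx)
  have e2 := abs_lt.1 (hf' y hy)
  rw [hxy] at e1
  simp only [h] at e1 e2
  rcases lt_or_gt_of_ne hne with hl | hl
  · have : (x:ℝ) + 1 ≤ y := by exact_mod_cast hl
    linarith
  · have : (y:ℝ) + 1 ≤ x := by exact_mod_cast hl
    linarith

lemma good_H (hRH : ∀ ρ : ℂ, zf ρ = 0 → 0 < ρ.re → |ρ.im| ≤ 30610046000 → ρ.re = 1 / 2) :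
    ∃ H : ℝ, 30610045000 ≤ H ∧ H ≤ 30610045999.5 ∧
      (∀ s : ℂ, 1 / 4 ≤ s.re → s.re ≤ 1.01 → (|s.im| = H ∨ (s.re = 1 / 4 ∧ |s.im| ≤ H)) →
        zf s ≠ 0 ∧ ‖deriv zf s / zf s‖ ≤ 3 * 10 ^ 7) := by
  obtain ⟨H, hH1, hH2, hH⟩ := exists_H hRH
  refine ⟨H, hH1, hH2, ?_⟩
  intro s hs1 hs2 hs
  have him : |s.im| ≤ H := by rcases hs with h | h; exacts [h.le, h.2]
  have hd : ∀ ρ, zf ρ = 0 → (1 / 10000 : ℝ) ≤ ‖s - ρ‖ := by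
    intro ρ h0
    have hre := Complex.abs_re_le_norm (s - ρ)
    have himm := Complex.abs_im_le_norm (s - ρ)
    rw [Complex.sub_re] at hre
    rw [Complex.sub_im] at himm
    by_cases hp : 0 < ρ.re
    · rcases hs with h | ⟨h, _⟩
      · have := hH ρ h0 hp
        rw [← h] at this
        have h3 := abs_abs_sub_abs_le_abs_sub ρ.im s.im
        rw [abs_sub_comm ρ.im] at h3
        linarith
      · by_cases hA : |ρ.im| ≤ 30610046000
        · have := hRH ρ h0 hp hA
          rw [this, h] at hre
          norm_num at hre ⊢
          linarith
        · push Not at hA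
          have h3 := abs_sub_abs_le_abs_sub ρ.im s.im
          rw [abs_sub_comm ρ.im] at h3
          linarith
    · push Not at hp
      have := le_abs_self (s.re - ρ.re)
      linarith
  constructor
  · intro h0
    have := hd s h0
    simp at this
    linarith
  · have hb := zf_logderiv_bound (t := s.im) (s := s) (by linarith) (by
      rw [mem_closedBall_iff_norm]
      have : s - ⟨2, s.im⟩ = ((s.re - 2 : ℝ) : ℂ) := by apply Complex.ext <;> simp
      rw [this, Complex.norm_real, Real.norm_eq_abs, abs_le]
      constructor <;> linarith) (by norm_num) hd
    norm_num at hb ⊢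
    linarith

end ZB

namespace ZB
open MeasureTheory Filter
open scoped Topology

/-- `ψ(e^v)` -/
noncomputable def pe (v : ℝ) : ℝ := Chebyshev.psi (Real.exp v)

lemma pe_nonneg (v : ℝ) : 0 ≤ pe v := Chebyshev.psi_nonneg _

lemma psi_le6 {x : ℝ} (hx : 0 ≤ x) : Chebyshev.psi x ≤ 6 * x := by
  have h := Chebyshev.psi_le_const_mul_self hx
  have h2 : Real.log 4 ≤ 2 := by
    have : Real.log 4 = 2 * Real.log 2 := by
      rw [show (4:ℝ) = 2 ^ 2 by norm_num, Real.log_pow]; norm_num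
    have := Real.log_two_lt_d9
    linarith
  nlinarith

lemma pe_le (v : ℝ) : pe v ≤ 6 * Real.exp v := psi_le6 (Real.exp_pos v).le

lemma pe_zero {v : ℝ} (hv : v ≤ 0) : pe v = 0 :=
  Chebyshev.psi_eq_zero_of_le_one (by simpa using hv)

lemma pe_mono : Monotone pe := fun _ _ h => Chebyshev.psi_mono (Real.exp_le_exp.2 h)

lemma pe_meas : Measurable pe := pe_mono.measurable

lemma expdom_int {c : ℝ} (hc : 1 < c) :
    IntegrableOn (fun v => 6 * Real.exp (-(c - 1) * v)) (Set.Ioi 0) :=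
  (integrableOn_exp_mul_Ioi (by linarith) 0).const_mul 6

lemma pe_exp_int {c : ℝ} (hc : 1 < c) : Integrable (fun v => pe v * Real.exp (-c * v)) := by
  have h1 : IntegrableOn (fun v => pe v * Real.exp (-c * v)) (Set.Ioi 0) := by
    refine Integrable.mono' (expdom_int hc) ?_ ?_
    · exact (pe_meas.mul (by fun_prop)).aestronglyMeasurable
    · refine Eventually.of_forall fun v => ?_
      rw [Real.norm_of_nonneg (mul_nonneg (pe_nonneg v) (Real.exp_pos _).le)]
      calc _ ≤ 6 * Real.exp v * Real.exp (-c * v) := by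
            gcongr; exact pe_le v
        _ = _ := by rw [mul_assoc, ← Real.exp_add]; congr 2; ring
  rw [← integrableOn_univ, ← Set.Iic_union_Ioi (a := (0:ℝ))]
  refine IntegrableOn.union ?_ h1
  refine (integrableOn_zero).congr_fun ?_ measurableSet_Iic
  intro v hv
  simp [pe_zero hv]

lemma pe_exp_bound {c : ℝ} (hc : 1 < c) : ∫ v in Set.Ioi 0, pe v * Real.exp (-c * v) ≤ 6 / (c - 1) := by
  have : ∫ v in Set.Ioi (0:ℝ), 6 * Real.exp (-(c - 1) * v) = 6 / (c - 1) := by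
    rw [integral_const_mul, integral_exp_mul_Ioi (by linarith)]
    have h1 : c - 1 ≠ 0 := by linarith
    rw [mul_zero, Real.exp_zero, neg_div_neg_eq]
    field_simp
  rw [← this]
  apply setIntegral_mono_on (pe_exp_int hc).integrableOn (expdom_int hc) measurableSet_Ioi
  intro v _
  calc _ ≤ 6 * Real.exp v * Real.exp (-c * v) := by
        gcongr; exact pe_le v
    _ = _ := by rw [mul_assoc, ← Real.exp_add]; congr 2; ring

lemma lseries_eq {s : ℂ} (hs : 1 < s.re) :
    LSeries (fun n => (ArithmeticFunction.vonMangoldt n : ℂ)) s =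
      s * ∫ v in Set.Ioi (0:ℝ), (pe v : ℂ) * Complex.exp (-s * v) := by
  rw [LSeries_eq_mul_integral_of_nonneg (fun n => ArithmeticFunction.vonMangoldt n) (r := 1) (by norm_num) hs ?_
    (fun n => ArithmeticFunction.vonMangoldt_nonneg)]
  · congr 1
    have := integral_comp_exp_Ioi
      (fun t : ℝ => (∑ k ∈ Finset.Icc 1 ⌊t⌋₊, ((ArithmeticFunction.vonMangoldt k : ℝ) : ℂ)) * (t:ℂ) ^ (-(s + 1))) 0
    rw [Real.exp_zero] at this
    rw [← this]
    refine setIntegral_congr_fun measurableSet_Ioi ?_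
    intro v hv
    simp only [pe]
    have e : Chebyshev.psi (Real.exp v) = ∑ k ∈ Finset.Icc 1 ⌊Real.exp v⌋₊, ArithmeticFunction.vonMangoldt k := by
      rw [Chebyshev.psi]; rfl
    rw [e]
    have e2 : ((Real.exp v : ℝ) : ℂ) ^ (-(s + 1)) = Complex.exp (-s * v) * Complex.exp (-v) := by
      rw [Complex.cpow_def_of_ne_zero (by exact_mod_cast (Real.exp_pos v).ne'), ← Complex.ofReal_log (Real.exp_pos v).le,
        Real.log_exp, ← Complex.exp_add]
      congr 1; ring
    rw [e2, Complex.real_smul]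
    push_cast
    have e3 : Complex.exp v * Complex.exp (-v) = 1 := by rw [← Complex.exp_add]; simp
    linear_combination (∑ k ∈ Finset.Icc 1 ⌊Real.exp v⌋₊, ((ArithmeticFunction.vonMangoldt k : ℝ) : ℂ)) *
      Complex.exp (-s * v) * e3
  · refine Asymptotics.IsBigO.of_bound 6 (Eventually.of_forall fun n => ?_)
    have h := psi_le6 (x := n) (Nat.cast_nonneg n)
    have e : Chebyshev.psi n = ∑ k ∈ Finset.Icc 1 n, ArithmeticFunction.vonMangoldt k := by
      rw [Chebyshev.psi, Nat.floor_natCast]; rfl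
    rw [← e, Real.norm_of_nonneg (Chebyshev.psi_nonneg _)]
    simpa using h

lemma pe_laplace {s : ℂ} (hs : 1 < s.re) :
    ∫ v, (pe v : ℂ) * Complex.exp (-s * v) = -(deriv riemannZeta s / riemannZeta s) / s := by
  have h0 : s ≠ 0 := by rintro rfl; norm_num at hs
  have h := lseries_eq hs
  rw [ArithmeticFunction.LSeries_vonMangoldt_eq_deriv_riemannZeta_div hs] at h
  have : ∫ v, (pe v : ℂ) * Complex.exp (-s * v) = ∫ v in Set.Ioi (0:ℝ), (pe v : ℂ) * Complex.exp (-s * v) := by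
    symm
    apply setIntegral_eq_integral_of_forall_compl_eq_zero
    intro v hv
    simp only [Set.mem_Ioi, not_lt] at hv
    simp [pe_zero hv]
  rw [this, eq_div_iff h0, mul_comm, ← h, neg_div]

lemma zeta_logderiv_le {s : ℂ} (hs : 1 < s.re) :
    ‖deriv riemannZeta s / riemannZeta s‖ ≤ s.re * (6 / (s.re - 1)) := by
  have h := ArithmeticFunction.LSeries_vonMangoldt_eq_deriv_riemannZeta_div hs
  rw [neg_div] at h
  rw [← norm_neg, ← h]
  have hsum := ArithmeticFunction.LSeriesSummable_vonMangoldt hs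
  have hn : Summable fun n => ‖LSeries.term (fun n => (ArithmeticFunction.vonMangoldt n : ℂ)) s n‖ := hsum.norm
  have h1 : ‖LSeries (fun n => (ArithmeticFunction.vonMangoldt n : ℂ)) s‖ ≤
      ∑' n, ‖LSeries.term (fun n => (ArithmeticFunction.vonMangoldt n : ℂ)) s n‖ := norm_tsum_le_tsum_norm hn
  refine h1.trans ?_
  have e : ∀ n, ((‖LSeries.term (fun n => (ArithmeticFunction.vonMangoldt n : ℂ)) s n‖ : ℝ) : ℂ) =
      LSeries.term (fun n => (ArithmeticFunction.vonMangoldt n : ℂ)) (s.re : ℂ) n := by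
    intro n
    rw [LSeries.norm_term_eq, LSeries.term_def]
    split_ifs with hn
    · simp
    · rw [Complex.norm_real, Real.norm_of_nonneg ArithmeticFunction.vonMangoldt_nonneg]
      push_cast
      rw [Complex.ofReal_cpow (Nat.cast_nonneg n)]; simp
  have e2 : ((∑' n, ‖LSeries.term (fun n => (ArithmeticFunction.vonMangoldt n : ℂ)) s n‖ : ℝ) : ℂ) =
      ((s.re * ∫ v in Set.Ioi (0:ℝ), pe v * Real.exp (-s.re * v) : ℝ) : ℂ) := by
    rw [Complex.ofReal_tsum]
    simp_rw [e]
    have := lseries_eq (s := (s.re : ℂ)) (by simpa using hs)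
    rw [LSeries] at this
    rw [this, Complex.ofReal_mul, ← integral_complex_ofReal]
    congr 2
    ext v
    push_cast
    rfl
  rw [Complex.ofReal_inj.1 e2]
  gcongr
  exact pe_exp_bound hs

end ZB

namespace ZB
open MeasureTheory Filter
open scoped Topology

/-- the Gaussian weight -/
noncomputable def gG (a w κ : ℝ) (s : ℂ) : ℂ :=
  Complex.exp ((s - κ) * w + (s - κ) ^ 2 / (2 * a))

lemma gG_diff (a w κ : ℝ) : Differentiable ℂ (gG a w κ) := by
  unfold gG; fun_prop

lemma gG_norm (a w κ : ℝ) (s : ℂ) :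
    ‖gG a w κ s‖ = Real.exp ((s.re - κ) * w + ((s.re - κ) ^ 2 - s.im ^ 2) / (2 * a)) := by
  rw [gG, Complex.norm_exp]
  congr 1
  have : (s - κ) ^ 2 / (2 * a) = (s - κ) ^ 2 / ((2 * a : ℝ) : ℂ) := by push_cast; rfl
  rw [this, Complex.add_re, Complex.div_ofReal_re, Complex.re_mul_ofReal]
  simp [pow_two]

lemma gG_line {a : ℝ} (ha : 0 < a) (w κ c v t : ℝ) :
    Complex.exp (-(c + t * Complex.I) * v) * gG a w κ (c + t * Complex.I) =
    Complex.exp (((-(1 / (2 * a)) : ℝ) : ℂ) * t ^ 2 + (Complex.I * (w - v + (c - κ) / a)) * t +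
      (-c * v + (c - κ) * w + (c - κ) ^ 2 / (2 * a))) := by
  rw [gG, ← Complex.exp_add]
  congr 1
  have : (a : ℂ) ≠ 0 := by exact_mod_cast ha.ne'
  push_cast
  field_simp
  linear_combination (t:ℂ) ^ 2 * Complex.I_sq

lemma gG_line_int {a : ℝ} (ha : 0 < a) (w κ c : ℝ) :
    Integrable (fun t : ℝ => gG a w κ (c + t * Complex.I)) := by
  have h := integrable_cexp_quadratic' (b := ((-(1 / (2 * a)) : ℝ) : ℂ)) (by simpa using ha)
    (Complex.I * (w - (0:ℝ) + (c - κ) / a)) (-c * (0:ℝ) + (c - κ) * w + (c - κ) ^ 2 / (2 * a))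
  refine h.congr (Eventually.of_forall fun t => ?_)
  have := gG_line ha w κ c 0 t
  simp only []
  rw [← this]; simp

lemma gG_fourier {a : ℝ} (ha : 0 < a) (w κ c v : ℝ) :
    ∫ t : ℝ, Complex.exp (-(c + t * Complex.I) * v) * gG a w κ (c + t * Complex.I) =
      2 * π * (gaussianK a (v - w) * Real.exp (-κ * v) : ℝ) := by
  simp_rw [gG_line ha]
  rw [integral_cexp_quadratic (by simpa using ha)]
  have ha' : (a : ℂ) ≠ 0 := by exact_mod_cast ha.ne'
  have e1 : ((π : ℂ) / -((-(1 / (2 * a)) : ℝ) : ℂ)) ^ (1 / 2 : ℂ) = ((2 * π * Real.sqrt (a / (2 * π)) : ℝ) : ℂ) := by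
    have : (π : ℂ) / -((-(1 / (2 * a)) : ℝ) : ℂ) = ((2 * π * a : ℝ) : ℂ) := by
      push_cast; field_simp
    rw [this, show (1 / 2 : ℂ) = ((1 / 2 : ℝ) : ℂ) by push_cast; rfl,
      ← Complex.ofReal_cpow (by positivity), ← Real.sqrt_eq_rpow]
    congr 1
    rw [Real.sqrt_eq_iff_mul_self_eq (by positivity) (by positivity)]
    have := Real.mul_self_sqrt (show 0 ≤ a / (2 * π) by positivity)
    symm
    calc _ = (2 * π) ^ 2 * (Real.sqrt (a / (2 * π)) * Real.sqrt (a / (2 * π))) := by ring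
      _ = _ := by rw [this]; field_simp
  rw [e1]
  have e2 : (-(c:ℂ) * v + (c - κ) * w + (c - κ) ^ 2 / (2 * a)) -
      (Complex.I * (w - v + (c - κ) / a)) ^ 2 / (4 * ((-(1 / (2 * a)) : ℝ) : ℂ)) =
      ((-a * (v - w) ^ 2 / 2 + -κ * v : ℝ) : ℂ) := by
    rw [mul_pow, Complex.I_sq]
    push_cast
    field_simp
    ring
  rw [e2, ← Complex.ofReal_exp, Real.exp_add, gaussianK]
  push_cast
  ring

lemma prod_int {a : ℝ} (ha : 0 < a) (w κ : ℝ) {c : ℝ} (hc : 1 < c) :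
    Integrable (fun q : ℝ × ℝ => ((pe q.2 : ℂ) * Complex.exp (-(c + q.1 * Complex.I) * q.2)) *
      gG a w κ (c + q.1 * Complex.I)) (volume.prod volume) := by
  have h := (gG_line_int ha w κ c).mul_prod ((pe_exp_int hc).ofReal (𝕜 := ℂ))
  refine h.mono ?_ ?_
  · apply Measurable.aestronglyMeasurable
    have := pe_meas
    have := (gG_diff a w κ).continuous.measurable
    fun_prop
  · refine Eventually.of_forall fun q => ?_
    simp only [norm_mul, Complex.norm_exp]
    apply le_of_eq
    simp [Complex.norm_exp]
    ring

lemma perron {a : ℝ} (ha : 0 < a) (w κ : ℝ) {c : ℝ} (hc : 1 < c) :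
    Integrable (fun t : ℝ => (deriv riemannZeta (c + t * Complex.I) / riemannZeta (c + t * Complex.I)) *
      (gG a w κ (c + t * Complex.I) / (c + t * Complex.I))) ∧
    ∫ t : ℝ, (deriv riemannZeta (c + t * Complex.I) / riemannZeta (c + t * Complex.I)) *
      (gG a w κ (c + t * Complex.I) / (c + t * Complex.I)) =
      - (2 * π * (∫ v, pe v * (gaussianK a (v - w) * Real.exp (-κ * v)) : ℝ)) := by
  have hp := prod_int ha w κ hc
  have e : ∀ t : ℝ, ∫ v : ℝ, ((pe v : ℂ) * Complex.exp (-(c + t * Complex.I) * v)) *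
      gG a w κ (c + t * Complex.I) = -((deriv riemannZeta (c + t * Complex.I) / riemannZeta (c + t * Complex.I)) *
      (gG a w κ (c + t * Complex.I) / (c + t * Complex.I))) := by
    intro t
    rw [integral_mul_const, pe_laplace (by simpa using hc)]
    ring
  have h1 := hp.integral_prod_left
  simp only [e] at h1
  refine ⟨by simpa using h1.neg, ?_⟩
  have h2 := integral_integral_swap (f := fun (t v : ℝ) => ((pe v : ℂ) * Complex.exp (-(c + t * Complex.I) * v)) *
      gG a w κ (c + t * Complex.I)) hp
  simp only [e] at h2
  rw [integral_neg, neg_eq_iff_eq_neg] at h2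
  rw [h2]
  congr 1
  simp_rw [mul_assoc, integral_const_mul, gG_fourier ha]
  rw [← integral_complex_ofReal, ← integral_const_mul, ← integral_const_mul]
  congr 1; ext v
  push_cast; ring

lemma perron_integrable {a : ℝ} (ha : 0 < a) (w κ : ℝ) :
    Integrable (fun v => pe v * (gaussianK a (v - w) * Real.exp (-κ * v))) := by
  have h := (prod_int ha w κ (c := 2) (by norm_num)).integral_prod_right
  simp_rw [mul_assoc, integral_const_mul, gG_fourier ha] at h
  have h2 := (h.const_mul (1 / (2 * π) : ℂ)).re
  refine h2.congr (Eventually.of_forall fun v => ?_)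
  have : (1 / (2 * π) : ℂ) * (pe v * (2 * (π * ((gaussianK a (v - w) * Real.exp (-κ * v) : ℝ) : ℂ)))) =
     ((pe v * (gaussianK a (v - w) * Real.exp (-κ * v)) : ℝ) : ℂ) := by
    have : (π : ℂ) ≠ 0 := by exact_mod_cast Real.pi_ne_zero
    push_cast
    field_simp
  simp only [mul_assoc] at this ⊢
  simp only [this, Complex.ofReal_re, RCLike.re_to_complex]

end ZB

namespace ZB
open MeasureTheory Filter
open scoped Topology

lemma zf_logderiv_eq {s : ℂ} (h1 : s ≠ 1) (h0 : riemannZeta s ≠ 0) :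
    deriv zf s / zf s = deriv riemannZeta s / riemannZeta s + 1 / (s - 1) := by
  have hs : s - 1 ≠ 0 := sub_ne_zero.2 h1
  have he : zf =ᶠ[𝓝 s] fun z => (z - 1) * riemannZeta z := by
    filter_upwards [isOpen_ne.mem_nhds h1] with z hz
    exact zf_of_ne hz
  have hd := (((hasDerivAt_id s).sub_const 1).mul (differentiableAt_riemannZeta h1).hasDerivAt).congr_of_eventuallyEq he
  rw [hd.deriv, zf_of_ne h1]
  simp only [id]
  field_simp
  ring

lemma tail_bound {f : ℝ → ℂ} {H M k : ℝ} (hk : 0 < k)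
    (hf : ∀ t, H < t → ‖f t‖ ≤ M * Real.exp (-k * t)) :
    ‖∫ t in Set.Ioi H, f t‖ ≤ M * (Real.exp (-k * H) / k) := by
  have hi := (integrableOn_exp_mul_Ioi (a := -k) (by linarith) H).const_mul M
  have := norm_integral_le_of_norm_le hi ((ae_restrict_iff' measurableSet_Ioi).2 (Eventually.of_forall hf))
  rw [integral_const_mul, integral_exp_mul_Ioi (by linarith), neg_div_neg_eq] at this
  exact this

lemma split_int {f : ℝ → ℂ} (hf : Integrable f) {H : ℝ} :
    ∫ t, f t = (∫ t in Set.Ioi H, f (-t)) + (∫ t in (-H)..H, f t) + ∫ t in Set.Ioi H, f t := by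
  rw [integral_comp_neg_Ioi, ← intervalIntegral.integral_Iic_sub_Iic hf.integrableOn hf.integrableOn]
  rw [← intervalIntegral.integral_Iic_add_Ioi (b := H) hf.integrableOn hf.integrableOn]
  ring

lemma gG_le {a w κ : ℝ} (ha : 1 ≤ a) (hw : 0 ≤ w) (hκ : 1 / 2 ≤ κ) (hκ1 : κ ≤ 1) {s : ℂ} {σ q : ℝ}
    (h1 : 1 / 4 ≤ s.re) (h2 : s.re ≤ σ) (hσ : σ ≤ 1.01) (hq : q ≤ s.im ^ 2) :
    ‖gG a w κ s‖ ≤ Real.exp ((σ - κ) * w + 1 - q / (2 * a)) := by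
  rw [gG_norm]
  apply Real.exp_le_exp.2
  have e1 : (s.re - κ) * w ≤ (σ - κ) * w := by gcongr
  have e2 : (s.re - κ) ^ 2 / (2 * a) ≤ 1 := by
    rw [div_le_one (by linarith)]; nlinarith
  have e3 : q / (2 * a) ≤ s.im ^ 2 / (2 * a) := by gcongr
  rw [sub_div]; linarith

theorem explicit {H : ℝ} (hH1 : 30610045000 ≤ H) (hH2 : H ≤ 30610045999.5)
    (hgood : ∀ s : ℂ, 1 / 4 ≤ s.re → s.re ≤ 1.01 → (|s.im| = H ∨ (s.re = 1 / 4 ∧ |s.im| ≤ H)) →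
        zf s ≠ 0 ∧ ‖deriv zf s / zf s‖ ≤ 3 * 10 ^ 7)
    (Z : Finset ℂ) (hZ : ∀ ρ, ρ ∈ Z ↔ ρ ∈ rect (1 / 4) 1.01 (-H) H ∧ zf ρ = 0)
    {a w κ : ℝ} (ha : 1 ≤ a) (ha2 : a ≤ 5 * 10 ^ 18) (hw : 0 ≤ w) (hκ : 1 / 2 ≤ κ) (hκ1 : κ ≤ 1) :
    ‖((∫ v, pe v * (gaussianK a (v - w) * Real.exp (-κ * v)) : ℝ) : ℂ) - gG a w κ 1 +
      ∑ ρ ∈ Z, (mu ρ : ℂ) * (gG a w κ ρ / ρ)‖ ≤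
      20 * Real.exp ((1.01 - κ) * w + 1 - H ^ 2 / (2 * a)) + 10 ^ 19 * Real.exp ((1 / 4 - κ) * w + 1) := by
  have ha0 : 0 < a := by linarith
  have hH0 : 0 < H := by linarith
  set P : ℝ := ∫ v, pe v * (gaussianK a (v - w) * Real.exp (-κ * v)) with hP
  set h : ℂ → ℂ := fun z => gG a w κ z / z with hh
  have hdiff : DifferentiableOn ℂ h (rect (1 / 4) 1.01 (-H) H) := by
    intro z hz
    refine DifferentiableAt.differentiableWithinAt ?_
    refine DifferentiableAt.div (gG_diff a w κ z) differentiableAt_id ?_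
    rintro rfl
    have := hz.1.1
    norm_num at this
  have hx : (1 / 4 : ℝ) < 1.01 := by norm_num
  have hy : -H < H := by linarith
  obtain ⟨i1, b1⟩ := bd_logderiv hx hy Z hZ (by
    intro ρ hρ
    obtain ⟨⟨⟨r1, r2⟩, r3, r4⟩, r0⟩ := (hZ ρ).1 hρ
    have r5 : |ρ.im| ≤ H := abs_le.2 ⟨r3, r4⟩
    have r6 : |ρ.im| ≠ H := fun e => (hgood ρ r1 r2 (Or.inl e)).1 r0
    have r7 := abs_lt.1 (lt_of_le_of_ne r5 r6)
    refine ⟨⟨lt_of_le_of_ne r1 ?_, ?_⟩, r7.1, r7.2⟩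
    · intro e
      exact (hgood ρ r1 r2 (Or.inr ⟨e.symm, r5⟩)).1 r0
    · by_contra hc
      push Not at hc
      exact zf_ne_zero_of_re (by linarith) r0) hdiff
  obtain ⟨i2, b2⟩ := bd_res (x0 := 1 / 4) (x1 := 1.01) (y0 := -H) (y1 := H) (ρ := 1) (by norm_num) (by norm_num)
    (by simpa using hH0) (by simpa using hH0) hdiff
  have b3 := bd_add i1 (i2.const_mul (-1))
  rw [b1, bd_const_mul, b2] at b3
  set F : ℂ → ℂ := fun z => deriv zf z / zf z * h z + -1 * (h z / (z - 1)) with hF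
  have hh1 : h 1 = gG a w κ 1 := by simp [hh]
  rw [hh1] at b3
  -- bounds for F
  have hFb : ∀ s : ℂ, 1 / 4 ≤ s.re → s.re ≤ 1.01 → (|s.im| = H ∨ (s.re = 1 / 4 ∧ |s.im| ≤ H)) →
      ‖F s‖ ≤ (3 * 10 ^ 7 + 2) * ‖h s‖ := by
    intro s h1 h2 h3
    have hb := (hgood s h1 h2 h3).2
    have hd : 1 / 2 ≤ ‖s - 1‖ := by
      rcases h3 with h3 | ⟨h3, _⟩
      · have := Complex.abs_im_le_norm (s - 1)
        simp only [Complex.sub_im, Complex.one_im, sub_zero] at this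
        linarith
      · have := Complex.abs_re_le_norm (s - 1)
        simp only [Complex.sub_re, Complex.one_re, h3] at this
        have := neg_abs_le (1 / 4 - 1 : ℝ)
        linarith
    calc ‖F s‖ ≤ ‖deriv zf s / zf s * h s‖ + ‖-1 * (h s / (s - 1))‖ := norm_add_le _ _
      _ = ‖deriv zf s / zf s‖ * ‖h s‖ + ‖h s‖ / ‖s - 1‖ := by simp
      _ ≤ (3 * 10 ^ 7) * ‖h s‖ + ‖h s‖ / (1 / 2) := by gcongr
      _ = _ := by ring
  set E1 := Real.exp ((1.01 - κ) * w + 1 - H ^ 2 / (2 * a)) with hE1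
  set E2 := Real.exp ((1 / 4 - κ) * w + 1) with hE2
  have hhor : ∀ y : ℝ, |y| = H → ‖∫ x in (1 / 4 : ℝ)..1.01, F (x + y * Complex.I)‖ ≤ E1 := by
    intro y hyH
    have := intervalIntegral.norm_integral_le_of_norm_le_const (a := (1 / 4 : ℝ)) (b := 1.01)
      (f := fun x : ℝ => F (x + y * Complex.I)) (C := E1) (by
      intro x hx'
      rw [Set.uIoc_of_le hx.le] at hx'
      have hre : ((x:ℂ) + y * Complex.I).re = x := by simp
      have him : ((x:ℂ) + y * Complex.I).im = y := by simp
      have hb := hFb (x + y * Complex.I) (by rw [hre]; exact hx'.1.le) (by rw [hre]; exact hx'.2) (Or.inl (by rw [him]; exact hyH))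
      refine hb.trans ?_
      have hg := gG_le ha hw hκ hκ1 (s := x + y * Complex.I) (σ := 1.01) (q := H ^ 2)
        (by rw [hre]; exact hx'.1.le) (by rw [hre]; exact hx'.2) le_rfl (by rw [him, ← hyH, sq_abs])
      have hn : H ≤ ‖(x:ℂ) + y * Complex.I‖ := by
        have := Complex.abs_im_le_norm ((x:ℂ) + y * Complex.I)
        rwa [him, hyH] at this
      have : ‖h (x + y * Complex.I)‖ ≤ E1 / H := by
        simp only [hh, norm_div]; gcongr
      calc _ ≤ (3 * 10 ^ 7 + 2) * (E1 / H) := by gcongr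
        _ = ((3 * 10 ^ 7 + 2) / H) * E1 := by ring
        _ ≤ 1 * E1 := by
          gcongr
          rw [div_le_one hH0]; linarith
        _ = E1 := one_mul _)
    refine this.trans ?_
    rw [abs_of_pos (by norm_num)]
    have : 0 < E1 := Real.exp_pos _
    linarith
  have hleft : ‖∫ y in (-H)..H, F (((1 / 4 : ℝ) : ℂ) + y * Complex.I)‖ ≤ 10 ^ 19 * E2 := by
    have := intervalIntegral.norm_integral_le_of_norm_le_const (a := -H) (b := H)
      (f := fun y : ℝ => F (((1 / 4 : ℝ) : ℂ) + y * Complex.I)) (C := (3 * 10 ^ 7 + 2) * (4 * E2)) (by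
      intro y hy'
      rw [Set.uIoc_of_le hy.le] at hy'
      have hre : (((1 / 4 : ℝ) : ℂ) + y * Complex.I).re = 1 / 4 := by simp
      have him : (((1 / 4 : ℝ) : ℂ) + y * Complex.I).im = y := by simp
      have hb := hFb (((1 / 4 : ℝ) : ℂ) + y * Complex.I) (by rw [hre]) (by rw [hre]; norm_num)
        (Or.inr (by rw [him, hre]; exact ⟨rfl, abs_le.2 ⟨hy'.1.le, hy'.2⟩⟩))
      refine hb.trans ?_
      have hg := gG_le ha hw hκ hκ1 (s := ((1 / 4 : ℝ) : ℂ) + y * Complex.I) (σ := 1 / 4) (q := 0)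
        (by rw [hre]) (by rw [hre]) (by norm_num) (by positivity)
      rw [zero_div, sub_zero] at hg
      have hn : 1 / 4 ≤ ‖((1 / 4 : ℝ) : ℂ) + y * Complex.I‖ := by
        have := Complex.abs_re_le_norm (((1 / 4 : ℝ) : ℂ) + y * Complex.I)
        rw [hre] at this
        exact (le_abs_self _).trans this
      have : ‖h (((1 / 4 : ℝ) : ℂ) + y * Complex.I)‖ ≤ E2 / (1 / 4) := by
        simp only [hh, norm_div]; gcongr
      calc _ ≤ (3 * 10 ^ 7 + 2) * (E2 / (1 / 4)) := by gcongr
        _ = _ := by ring)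
    refine this.trans ?_
    rw [abs_of_pos (by linarith)]
    have : 0 < E2 := Real.exp_pos _
    nlinarith
  -- right side
  obtain ⟨pi1, pe1⟩ := perron ha0 w κ (c := 1.01) (by norm_num)
  rw [← hP] at pe1
  set f : ℝ → ℂ := fun t => (deriv riemannZeta (((1.01 : ℝ) : ℂ) + t * Complex.I) / riemannZeta (((1.01 : ℝ) : ℂ) + t * Complex.I)) *
      (gG a w κ (((1.01 : ℝ) : ℂ) + t * Complex.I) / (((1.01 : ℝ) : ℂ) + t * Complex.I)) with hf
  have hFf : ∀ t : ℝ, F (((1.01 : ℝ) : ℂ) + t * Complex.I) = f t := by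
    intro t
    have hre : (((1.01 : ℝ) : ℂ) + t * Complex.I).re = 1.01 := by simp
    have hne : ((1.01 : ℝ) : ℂ) + t * Complex.I ≠ 1 := by
      intro e; rw [e] at hre; norm_num at hre
    have hz : riemannZeta (((1.01 : ℝ) : ℂ) + t * Complex.I) ≠ 0 :=
      riemannZeta_ne_zero_of_one_le_re (by rw [hre]; norm_num)
    simp only [hF, hf, zf_logderiv_eq hne hz, hh]
    ring
  have hsplit := split_int pi1 (H := H)
  rw [pe1] at hsplit
  have htail : ∀ ε : ℝ, (ε = 1 ∨ ε = -1) → ‖∫ t in Set.Ioi H, f (ε * t)‖ ≤ 8 * E1 := by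
    intro ε hε
    have hk : 0 < H / (2 * a) := by positivity
    have := tail_bound (f := fun t => f (ε * t)) (H := H) (M := 606 / H * Real.exp ((1.01 - κ) * w + 1)) hk (by
      intro t ht
      have ht0 : 0 < t := by linarith
      have hre : (((1.01 : ℝ) : ℂ) + (ε * t : ℝ) * Complex.I).re = 1.01 := by simp
      have him : (((1.01 : ℝ) : ℂ) + (ε * t : ℝ) * Complex.I).im = ε * t := by simp
      have hsq : (ε * t) ^ 2 = t ^ 2 := by rcases hε with rfl | rfl <;> ring
      have habs : |ε * t| = t := by
        rw [← abs_of_pos ht0, ← sq_eq_sq_iff_abs_eq_abs]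
        rw [abs_of_pos ht0]; exact hsq
      have hg := gG_le ha hw hκ hκ1 (s := ((1.01 : ℝ) : ℂ) + (ε * t : ℝ) * Complex.I) (σ := 1.01) (q := H * t)
        (by rw [hre]; norm_num) (by rw [hre]) le_rfl (by rw [him, hsq]; nlinarith)
      have hz := zeta_logderiv_le (s := ((1.01 : ℝ) : ℂ) + (ε * t : ℝ) * Complex.I) (by rw [hre]; norm_num)
      rw [hre] at hz
      have hn : H ≤ ‖((1.01 : ℝ) : ℂ) + (ε * t : ℝ) * Complex.I‖ := by
        have := Complex.abs_im_le_norm (((1.01 : ℝ) : ℂ) + (ε * t : ℝ) * Complex.I)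
        rw [him, habs] at this
        linarith
      simp only [hf, norm_mul, norm_div] at hz ⊢
      calc _ ≤ (1.01 * (6 / (1.01 - 1))) * (Real.exp ((1.01 - κ) * w + 1 - H * t / (2 * a)) / H) := by gcongr
        _ = 606 / H * Real.exp ((1.01 - κ) * w + 1 - H * t / (2 * a)) := by ring
        _ = _ := by
          rw [mul_assoc, ← Real.exp_add]; congr 2; ring)
    refine this.trans ?_
    have e : Real.exp ((1.01 - κ) * w + 1) * Real.exp (-(H / (2 * a)) * H) = E1 := by
      rw [hE1, ← Real.exp_add]; congr 1; ring
    have e2 : 606 / H * Real.exp ((1.01 - κ) * w + 1) * (Real.exp (-(H / (2 * a)) * H) / (H / (2 * a))) =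
        (1212 * a / H ^ 2) * E1 := by
      rw [← e]; field_simp; ring
    rw [e2]
    have : 0 < E1 := Real.exp_pos _
    gcongr
    rw [div_le_iff₀ (by positivity)]
    nlinarith
  have t1 := htail 1 (Or.inl rfl)
  have t2 := htail (-1) (Or.inr rfl)
  simp only [one_mul, neg_mul] at t1 t2
  have hh1 := hhor H (abs_of_pos hH0)
  have hh2 := hhor (-H) (by rw [abs_neg, abs_of_pos hH0])
  -- assemble
  have hbd : bd F (1 / 4) 1.01 (-H) H =
    (∫ x in (1 / 4 : ℝ)..1.01, F (x + ((-H : ℝ) : ℂ) * Complex.I)) - (∫ x in (1 / 4 : ℝ)..1.01, F (x + H * Complex.I)) +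
    Complex.I * (∫ y in (-H)..H, f y) -
    Complex.I * (∫ y in (-H)..H, F (((1 / 4 : ℝ) : ℂ) + y * Complex.I)) := by
    rw [bd]; simp only [hFf]
  rw [hbd] at b3
  set X := ((P : ℝ) : ℂ) - gG a w κ 1 + ∑ ρ ∈ Z, (mu ρ : ℂ) * (gG a w κ ρ / ρ) with hX
  have key : 2 * π * Complex.I * X = (∫ x in (1 / 4 : ℝ)..1.01, F (x + ((-H : ℝ) : ℂ) * Complex.I))
      - (∫ x in (1 / 4 : ℝ)..1.01, F (x + H * Complex.I))
      - Complex.I * (∫ y in (-H)..H, F (((1 / 4 : ℝ) : ℂ) + y * Complex.I))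
      - Complex.I * (∫ t in Set.Ioi H, f (-t)) - Complex.I * (∫ t in Set.Ioi H, f t) := by
    rw [hX]
    linear_combination -Complex.I * hsplit - b3
  have hnorm := congrArg norm key
  have hpi := Real.pi_gt_three
  have hl : ‖2 * π * Complex.I * X‖ = 2 * π * ‖X‖ := by
    simp [abs_of_pos Real.pi_pos]
  rw [hl] at hnorm
  have htri : ∀ p q r s t : ℂ, ‖p - q - Complex.I * r - Complex.I * s - Complex.I * t‖ ≤ ‖p‖ + ‖q‖ + ‖r‖ + ‖s‖ + ‖t‖ := by
    intro p q r s t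
    have n1 := norm_sub_le (p - q - Complex.I * r - Complex.I * s) (Complex.I * t)
    have n2 := norm_sub_le (p - q - Complex.I * r) (Complex.I * s)
    have n3 := norm_sub_le (p - q) (Complex.I * r)
    have n4 := norm_sub_le p q
    simp only [norm_mul, Complex.norm_I, one_mul] at n1 n2 n3
    linarith
  have := hnorm.le.trans (htri _ _ _ _ _)
  have hX0 : 0 ≤ ‖X‖ := norm_nonneg X
  have : ‖X‖ ≤ 2 * π * ‖X‖ := by nlinarith
  have : 0 < E1 := Real.exp_pos _
  linarith

end ZB

namespace ZB
open MeasureTheory Filter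
open scoped Topology

lemma gaussianK_pdf {a : ℝ} (ha : 0 < a) (m u : ℝ) :
    gaussianK a (u - m) = ProbabilityTheory.gaussianPDFReal m (Real.toNNReal (1 / a)) u := by
  rw [ProbabilityTheory.gaussianPDFReal, gaussianK, Real.coe_toNNReal _ (by positivity)]
  congr 1
  · rw [← Real.sqrt_inv]; congr 1; field_simp
  · congr 1; field_simp

lemma gaussianK_nonneg (a y : ℝ) : 0 ≤ gaussianK a y := by
  unfold gaussianK; positivity

lemma gaussianK_shift {a : ℝ} (ha : 0 < a) (b w u : ℝ) :
    gaussianK a (u - w) * Real.exp (b * u) =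
      Real.exp (b * w + b ^ 2 / (2 * a)) * gaussianK a (u - (w + b / a)) := by
  unfold gaussianK
  rw [mul_assoc, ← Real.exp_add, mul_left_comm, ← Real.exp_add]
  congr 2
  field_simp; ring

lemma gauss_int {a : ℝ} (ha : 0 < a) (b w : ℝ) :
    Integrable (fun u => gaussianK a (u - w) * Real.exp (b * u)) ∧
    ∫ u, gaussianK a (u - w) * Real.exp (b * u) = Real.exp (b * w + b ^ 2 / (2 * a)) := by
  have hv : Real.toNNReal (1 / a) ≠ 0 := by
    have : 0 < 1 / a := by positivity
    simpa using ha
  simp_rw [gaussianK_shift ha, gaussianK_pdf ha]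
  refine ⟨(ProbabilityTheory.integrable_gaussianPDFReal _ _).const_mul _, ?_⟩
  rw [integral_const_mul, ProbabilityTheory.integral_gaussianPDFReal_eq_one _ hv, mul_one]

lemma gauss_one {a : ℝ} (ha : 0 < a) (w : ℝ) :
    Integrable (fun u => gaussianK a (u - w)) ∧ ∫ u, gaussianK a (u - w) = 1 := by
  have := gauss_int ha 0 w
  simpa using this

lemma theta_eq (x : ℝ) : chebyshevTheta x = Chebyshev.theta x := by
  rw [chebyshevTheta, Chebyshev.theta]
  apply Finset.sum_congr _ (fun _ _ => rfl)
  ext p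
  simp only [Finset.mem_filter, Finset.mem_range, Finset.mem_Ioc]
  constructor
  · rintro ⟨h1, h2⟩; exact ⟨⟨h2.pos, by omega⟩, h2⟩
  · rintro ⟨h1, h2⟩; exact ⟨by omega, h2⟩

lemma gaussianK_tail {a y η : ℝ} (ha : 0 < a) (hη : 0 ≤ η) (hy : η ≤ |y|) :
    gaussianK a y ≤ 2 * Real.exp (-a * η ^ 2 / 4) * gaussianK (a / 2) y := by
  unfold gaussianK
  have h1 : Real.sqrt (a / (2 * π)) ≤ 2 * Real.sqrt (a / 2 / (2 * π)) := by
    rw [show (2:ℝ) * Real.sqrt (a / 2 / (2 * π)) = Real.sqrt (2 ^ 2 * (a / 2 / (2 * π))) by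
      rw [Real.sqrt_mul (by norm_num), Real.sqrt_sq (by norm_num)]]
    apply Real.sqrt_le_sqrt
    have : 0 < a / (2 * π) := by positivity
    have e : 2 ^ 2 * (a / 2 / (2 * π)) = 2 * (a / (2 * π)) := by ring
    linarith
  have hsq : η ^ 2 ≤ y ^ 2 := by rw [← sq_abs y]; gcongr
  calc Real.sqrt (a / (2 * π)) * Real.exp (-a * y ^ 2 / 2) ≤
      (2 * Real.sqrt (a / 2 / (2 * π))) * (Real.exp (-a * η ^ 2 / 4) * Real.exp (-(a / 2) * y ^ 2 / 2)) := by
        gcongr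
        rw [← Real.exp_add]
        apply Real.exp_le_exp.2
        nlinarith
    _ = _ := by ring

lemma half_int {a : ℝ} (ha : 0 < a) (w : ℝ) :
    Integrable (fun u => pe (u / 2) * (gaussianK a (u - w) * Real.exp (-u / 2))) ∧
    ∫ u, pe (u / 2) * (gaussianK a (u - w) * Real.exp (-u / 2)) =
      ∫ v, pe v * (gaussianK (4 * a) (v - w / 2) * Real.exp (-1 * v)) := by
  have hp := perron_integrable (a := 4 * a) (by linarith) (w / 2) 1
  have e : ∀ u, pe (u / 2) * (gaussianK a (u - w) * Real.exp (-u / 2)) =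
      (1 / 2) * (fun v => pe v * (gaussianK (4 * a) (v - w / 2) * Real.exp (-1 * v))) (u / 2) := by
    intro u
    have : gaussianK (4 * a) (u / 2 - w / 2) = 2 * gaussianK a (u - w) := by
      unfold gaussianK
      rw [show (4 * a) / (2 * π) = 2 ^ 2 * (a / (2 * π)) by ring, Real.sqrt_mul (by norm_num), Real.sqrt_sq (by norm_num)]
      rw [show -(4 * a) * (u / 2 - w / 2) ^ 2 / 2 = -a * (u - w) ^ 2 / 2 by ring]
      ring
    simp only [this]
    rw [show -1 * (u / 2) = -u / 2 by ring]
    ring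
  simp_rw [e]
  refine ⟨(hp.comp_div (by norm_num)).const_mul _, ?_⟩
  rw [integral_const_mul, Measure.integral_comp_div (fun v => pe v * (gaussianK (4 * a) (v - w / 2) * Real.exp (-1 * v))) 2]
  rw [abs_of_pos (by norm_num), smul_eq_mul]; ring

theorem final_ineq {a w η : ℝ} (ha : 0 < a) (hη : 0 < η) (hw : 720 ≤ w - η) :
    (∫ v, pe v * (gaussianK a (v - w) * Real.exp (-(1 / 2) * v))) -
      (∫ v, pe v * (gaussianK (4 * a) (v - w / 2) * Real.exp (-1 * v))) -
      Real.exp (1 / 2 * w + (1 / 2) ^ 2 / (2 * a)) - 12 * Real.exp (-120) -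
      12 * Real.exp (-a * η ^ 2 / 4) * Real.exp (1 / 2 * w + (1 / 2) ^ 2 / (2 * (a / 2))) ≤
    ∫ u in (w - η)..(w + η), gaussianK a (u - w) * Real.exp (-u / 2) *
          (chebyshevTheta (Real.exp u) - Real.exp u) := by
  have hA := perron_integrable ha w (1 / 2)
  set fA : ℝ → ℝ := fun v => pe v * (gaussianK a (v - w) * Real.exp (-(1 / 2) * v)) with hfA
  obtain ⟨hB, hBe⟩ := half_int ha w
  rw [← hBe]
  set fB : ℝ → ℝ := fun u => pe (u / 2) * (gaussianK a (u - w) * Real.exp (-u / 2)) with hfB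
  obtain ⟨hC, hCe⟩ := gauss_one ha w
  obtain ⟨hD, hDe⟩ := gauss_int ha (1 / 2) w
  obtain ⟨hT, hTe⟩ := gauss_int (half_pos ha) (1 / 2) w
  rw [← hDe, ← hTe]
  have hAB : ∀ v, 0 ≤ fA v := fun v => mul_nonneg (pe_nonneg v) (mul_nonneg (gaussianK_nonneg _ _) (Real.exp_pos _).le)
  have hBB : ∀ v, 0 ≤ fB v := fun v => mul_nonneg (pe_nonneg _) (mul_nonneg (gaussianK_nonneg _ _) (Real.exp_pos _).le)
  have hle : w - η ≤ w + η := by linarith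
  set W := Set.Ioc (w - η) (w + η) with hW
  have hWm : MeasurableSet W := measurableSet_Ioc
  rw [intervalIntegral.integral_of_le hle]
  -- lower bound on the window
  have hIntg : IntegrableOn (fun u => gaussianK a (u - w) * Real.exp (-u / 2) *
          (chebyshevTheta (Real.exp u) - Real.exp u)) W := by
    rw [← intervalIntegrable_iff_integrableOn_Ioc_of_le hle]
    have hmono : Monotone fun u => Chebyshev.theta (Real.exp u) :=
      fun x y h => Chebyshev.theta_mono (Real.exp_le_exp.2 h)
    have h1 : IntervalIntegrable (fun u => chebyshevTheta (Real.exp u) - Real.exp u) volume (w - η) (w + η) := by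
      simp_rw [theta_eq]
      exact hmono.intervalIntegrable.sub (Continuous.intervalIntegrable (by fun_prop) _ _)
    refine h1.continuousOn_mul ?_
    unfold gaussianK
    fun_prop
  have hpt : ∀ u ∈ W, fA u - fB u - gaussianK a (u - w) * Real.exp (1 / 2 * u) - 12 * Real.exp (-120) * gaussianK a (u - w) ≤
      gaussianK a (u - w) * Real.exp (-u / 2) * (chebyshevTheta (Real.exp u) - Real.exp u) := by
    intro u hu
    have hu0 : 720 ≤ u := by linarith [hu.1]
    rw [theta_eq]
    have h1 := Chebyshev.psi_sub_theta_le_psi_add_psi_add_psi (Real.exp u)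
    have hr : ∀ x : ℝ, Real.exp u ^ x = Real.exp (u * x) := fun x => by rw [← Real.exp_mul]
    simp only [hr] at h1
    have h2 := psi_le6 (Real.exp_pos (u * (3:ℝ)⁻¹)).le
    have h3 := psi_le6 (Real.exp_pos (u * (5:ℝ)⁻¹)).le
    have h4 : Real.exp (u * (5:ℝ)⁻¹) ≤ Real.exp (u * (3:ℝ)⁻¹) := by
      apply Real.exp_le_exp.2; nlinarith
    have hpe2 : Chebyshev.psi (Real.exp (u * (2:ℝ)⁻¹)) = pe (u / 2) := by rw [pe]; rfl
    have hpe1 : Chebyshev.psi (Real.exp u) = pe u := rfl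
    rw [hpe2, hpe1] at h1
    have h5 : pe u - pe (u / 2) - 12 * Real.exp (u * (3:ℝ)⁻¹) - Real.exp u ≤
        Chebyshev.theta (Real.exp u) - Real.exp u := by linarith
    have hk := gaussianK_nonneg a (u - w)
    have h6 := mul_le_mul_of_nonneg_left h5 (mul_nonneg hk (Real.exp_pos (-u / 2)).le)
    refine le_trans ?_ h6
    have e1 : Real.exp (-u / 2) * Real.exp u = Real.exp (1 / 2 * u) := by rw [← Real.exp_add]; congr 1; ring
    have e2 : Real.exp (-u / 2) * Real.exp (u * (3:ℝ)⁻¹) ≤ Real.exp (-120) := by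
      rw [← Real.exp_add]; apply Real.exp_le_exp.2; linarith
    have e3 : Real.exp (-(1 / 2) * u) = Real.exp (-u / 2) := by congr 1; ring
    simp only [hfA, hfB, e3]
    have e4 := mul_le_mul_of_nonneg_left e2 hk
    rw [← e1]
    nlinarith
  have hlow := setIntegral_mono_on (((hA.sub hB).sub hD).sub (hC.const_mul (12 * Real.exp (-120)))).integrableOn hIntg hWm
    (fun u hu => by simpa using hpt u hu)
  refine le_trans ?_ hlow
  have hs : ∫ u in W, (((fA - fB) - fun u => gaussianK a (u - w) * Real.exp (1 / 2 * u)) -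
      fun u => 12 * Real.exp (-120) * gaussianK a (u - w)) u =
      (∫ u in W, fA u) - (∫ u in W, fB u) - (∫ u in W, gaussianK a (u - w) * Real.exp (1 / 2 * u)) -
      12 * Real.exp (-120) * ∫ u in W, gaussianK a (u - w) := by
    simp only [Pi.sub_apply]
    rw [integral_sub, integral_sub, integral_sub, integral_const_mul]
    exacts [hA.integrableOn, hB.integrableOn, (hA.sub hB).integrableOn, hD.integrableOn,
      ((hA.sub hB).sub hD).integrableOn, (hC.const_mul _).integrableOn]
  rw [hs]
  have s1 : ∫ u in W, fB u ≤ ∫ u, fB u := setIntegral_le_integral hB (Eventually.of_forall hBB)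
  have s2 : ∫ u in W, gaussianK a (u - w) * Real.exp (1 / 2 * u) ≤ ∫ u, gaussianK a (u - w) * Real.exp (1 / 2 * u) :=
    setIntegral_le_integral hD (Eventually.of_forall fun u => mul_nonneg (gaussianK_nonneg _ _) (Real.exp_pos _).le)
  have s3 : ∫ u in W, gaussianK a (u - w) ≤ 1 := by
    rw [← hCe]; exact setIntegral_le_integral hC (Eventually.of_forall fun u => gaussianK_nonneg _ _)
  have s3' : 12 * Real.exp (-120) * ∫ u in W, gaussianK a (u - w) ≤ 12 * Real.exp (-120) * 1 := by gcongr
  have s4 : ∫ u, fA u = (∫ u in W, fA u) + ∫ u in Wᶜ, fA u := (integral_add_compl hWm hA).symm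
  have s5 : ∫ u in Wᶜ, fA u ≤ ∫ u in Wᶜ, 12 * Real.exp (-a * η ^ 2 / 4) * (gaussianK (a / 2) (u - w) * Real.exp (1 / 2 * u)) := by
    refine setIntegral_mono_on hA.integrableOn (hT.const_mul _).integrableOn hWm.compl ?_
    intro u hu
    have hab : η ≤ |u - w| := by
      by_contra hc
      push Not at hc
      have := abs_lt.1 hc
      exact hu ⟨by linarith, by linarith⟩
    have h1 := gaussianK_tail ha hη.le hab
    have h2 := pe_le u
    have e1 : Real.exp u * Real.exp (-(1 / 2) * u) = Real.exp (1 / 2 * u) := by rw [← Real.exp_add]; congr 1; ring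
    have hk := gaussianK_nonneg a (u - w)
    calc fA u ≤ (6 * Real.exp u) * ((2 * Real.exp (-a * η ^ 2 / 4) * gaussianK (a / 2) (u - w)) * Real.exp (-(1 / 2) * u)) := by
          simp only [hfA]; gcongr
      _ = _ := by rw [← e1]; ring
  have s6 : ∫ u in Wᶜ, 12 * Real.exp (-a * η ^ 2 / 4) * (gaussianK (a / 2) (u - w) * Real.exp (1 / 2 * u)) ≤
      ∫ u, 12 * Real.exp (-a * η ^ 2 / 4) * (gaussianK (a / 2) (u - w) * Real.exp (1 / 2 * u)) :=
    setIntegral_le_integral (hT.const_mul _) (Eventually.of_forall fun u => by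
      have := gaussianK_nonneg (a / 2) (u - w)
      positivity)
  have s7 := s5.trans s6
  rw [integral_const_mul] at s7
  linarith

end ZB

namespace ZB
open MeasureTheory Filter
open scoped Topology

lemma exp_neg_le {x : ℝ} (n : ℕ) (hx : x ≤ -n) : Real.exp x ≤ (10 / 27) ^ n := by
  have h := exp_nat_lb n
  have h2 : (2.7 : ℝ) ^ n ≤ Real.exp n := le_trans (by gcongr; norm_num) h
  calc Real.exp x ≤ Real.exp (-n) := Real.exp_le_exp.2 hx
    _ = (Real.exp n)⁻¹ := Real.exp_neg _
    _ ≤ ((2.7 : ℝ) ^ n)⁻¹ := by gcongr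
    _ = _ := by rw [← inv_pow]; norm_num

lemma count_all (Z : Finset ℂ) (hre : ∀ ρ ∈ Z, ρ.re = 1 / 2)
    (him : ∀ ρ ∈ Z, |ρ.im| ≤ 30610046000) : ∑ ρ ∈ Z, (mu ρ : ℝ) ≤ 10 ^ 14 := by
  classical
  have hmaps : ∀ ρ ∈ Z, round ρ.im ∈ Finset.Icc (-30610046001 : ℤ) 30610046001 := by
    intro ρ hρ
    have h1 := abs_le.1 (him ρ hρ)
    have h2 := abs_le.1 (abs_sub_round ρ.im)
    rw [Finset.mem_Icc]
    constructor
    · have : (-30610046001 : ℝ) ≤ (round ρ.im : ℝ) := by linarith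
      exact_mod_cast this
    · have : (round ρ.im : ℝ) ≤ 30610046001 := by linarith
      exact_mod_cast this
  rw [← Finset.sum_fiberwise_of_maps_to hmaps]
  calc _ ≤ ∑ k ∈ Finset.Icc (-30610046001 : ℤ) 30610046001, (1000 : ℝ) := by
        apply Finset.sum_le_sum
        intro k hk
        rw [Finset.mem_Icc] at hk
        apply crude_count (t := (k : ℝ))
        · rw [abs_le]
          have k1 : (-30610046001 : ℝ) ≤ k := by exact_mod_cast hk.1
          have k2 : (k : ℝ) ≤ 30610046001 := by exact_mod_cast hk.2
          constructor <;> linarith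
        · intro ρ hρ
          rw [Finset.mem_filter] at hρ
          have h2 := abs_le.1 (abs_sub_round ρ.im)
          rw [hρ.2] at h2
          rw [mem_closedBall_iff_norm, ← abs_of_nonneg (norm_nonneg (ρ - _)), ← abs_of_nonneg (show (0:ℝ) ≤ 1.8 by norm_num),
            ← sq_le_sq, Complex.sq_norm, Complex.normSq_apply]
          simp only [Complex.sub_re, Complex.sub_im, hre ρ hρ.1]
          nlinarith
    _ ≤ 10 ^ 14 := by
        rw [Finset.sum_const, Int.card_Icc,
          show ((30610046001 : ℤ) + 1 - (-30610046001 : ℤ)).toNat = 61220092003 from rfl]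
        norm_num

lemma gG_half {a w : ℝ} {ρ : ℂ} (h : ρ.re = 1 / 2) :
    gG a w (1 / 2 : ℝ) ρ = Complex.exp (Complex.I * (ρ.im * w)) * Real.exp (-(ρ.im) ^ 2 / (2 * a)) := by
  rw [gG, Complex.ofReal_exp, ← Complex.exp_add]
  have : ρ - ((1 / 2 : ℝ) : ℂ) = Complex.I * ρ.im := by
    apply Complex.ext <;> simp [h]
  rw [this]
  congr 1
  push_cast
  rw [mul_pow, Complex.I_sq]
  ring

theorem main
    (hRH : ∀ ρ : ℂ, IsNontrivialZetaZero ρ → |ρ.im| ≤ 30610046000 → ρ.re = 1 / 2)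
    (hsum :
      (∑ᶠ ρ ∈ {ρ : ℂ | IsNontrivialZetaZero ρ ∧ |ρ.im| ≤ 6970346000},
          (zetaZeroMultiplicity ρ : ℂ) *
            (Complex.exp (Complex.I * (ρ.im * (727.951332655 : ℝ))) / ρ *
              Real.exp (-(ρ.im) ^ 2 / (2 * 1153308722614227968)))).re ∈
        Set.Icc (-1.0013360278 : ℝ) (-1.0013360277 : ℝ)) :
    (0.0013360261 : ℝ) < ∫ u in ((727.951332655 : ℝ) - 933831 / 2 ^ 44)..(727.951332655 + 933831 / 2 ^ 44),
        gaussianK 1153308722614227968 (u - 727.951332655) * Real.exp (-u / 2) *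
          (chebyshevTheta (Real.exp u) - Real.exp u) := by
  classical
  have hRH' : ∀ ρ : ℂ, zf ρ = 0 → 0 < ρ.re → |ρ.im| ≤ 30610046000 → ρ.re = 1 / 2 :=
    fun ρ h0 h1 h2 => hRH ρ (nontriv_iff.2 ⟨h0, h1⟩) h2
  obtain ⟨H, hH1, hH2, hgood⟩ := good_H hRH'
  have hfin := zeros_finite (isCompact_closedBall (0 : ℂ) (10 ^ 12))
  set Z : Finset ℂ := hfin.toFinset.filter (fun ρ => ρ ∈ rect (1 / 4) 1.01 (-H) H) with hZdef
  have hZ : ∀ ρ, ρ ∈ Z ↔ ρ ∈ rect (1 / 4) 1.01 (-H) H ∧ zf ρ = 0 := by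
    intro ρ
    rw [hZdef, Finset.mem_filter, hfin.mem_toFinset]
    constructor
    · rintro ⟨⟨_, h1⟩, h2⟩; exact ⟨h2, h1⟩
    · rintro ⟨h2, h1⟩
      refine ⟨⟨?_, h1⟩, h2⟩
      rw [mem_closedBall_zero_iff]
      obtain ⟨⟨r1, r2⟩, r3, r4⟩ := h2
      have hn := Complex.norm_le_abs_re_add_abs_im ρ
      have b1 : |ρ.re| ≤ 2 := abs_le.2 ⟨by linarith, by linarith⟩
      have b2 : |ρ.im| ≤ H := abs_le.2 ⟨r3, r4⟩
      linarith
  have hZim : ∀ ρ ∈ Z, |ρ.im| ≤ 30610046000 := by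
    intro ρ hρ
    obtain ⟨_, r3, r4⟩ := ((hZ ρ).1 hρ).1
    have b2 : |ρ.im| ≤ H := abs_le.2 ⟨r3, r4⟩
    linarith
  have hZre : ∀ ρ ∈ Z, ρ.re = 1 / 2 := by
    intro ρ hρ
    obtain ⟨⟨⟨r1, r2⟩, r3, r4⟩, r0⟩ := (hZ ρ).1 hρ
    exact hRH' ρ r0 (by linarith) (hZim ρ hρ)
  have X1 := explicit hH1 hH2 hgood Z hZ (a := 1153308722614227968) (w := 727.951332655) (κ := (1 / 2 : ℝ))
    (by norm_num) (by norm_num) (by norm_num) (by norm_num) (by norm_num)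
  have X2 := explicit hH1 hH2 hgood Z hZ (a := 4 * 1153308722614227968) (w := 727.951332655 / 2) (κ := (1 : ℝ))
    (by norm_num) (by norm_num) (by norm_num) (by norm_num) (by norm_num)
  have hfinal := final_ineq (a := 1153308722614227968) (w := 727.951332655) (η := 933831 / 2 ^ 44)
    (by norm_num) (by norm_num) (by norm_num)
  set P1 : ℝ := ∫ v, pe v * (gaussianK 1153308722614227968 (v - 727.951332655) * Real.exp (-(1 / 2) * v))
  set P2 : ℝ := ∫ v, pe v * (gaussianK (4 * 1153308722614227968) (v - 727.951332655 / 2) * Real.exp (-1 * v))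
  set J : ℝ := ∫ u in ((727.951332655 : ℝ) - 933831 / 2 ^ 44)..(727.951332655 + 933831 / 2 ^ 44),
        gaussianK 1153308722614227968 (u - 727.951332655) * Real.exp (-u / 2) *
          (chebyshevTheta (Real.exp u) - Real.exp u)
  have hHsq : (30610045000 : ℝ) ^ 2 ≤ H ^ 2 := by gcongr
  -- numeric bounds
  have n1 : Real.exp ((1.01 - 1 / 2) * 727.951332655 + 1 - H ^ 2 / (2 * 1153308722614227968)) ≤ (10 / 27) ^ 33 := by
    apply exp_neg_le
    norm_num at hHsq ⊢
    linarith
  have n2 : Real.exp ((1 / 4 - 1 / 2) * 727.951332655 + 1) ≤ (10 / 27) ^ 180 := by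
    apply exp_neg_le; norm_num
  have n3 : Real.exp ((1.01 - 1) * (727.951332655 / 2) + 1 - H ^ 2 / (2 * (4 * 1153308722614227968))) ≤ (10 / 27) ^ 96 := by
    apply exp_neg_le
    norm_num at hHsq ⊢
    linarith
  have n4 : Real.exp ((1 / 4 - 1) * (727.951332655 / 2) + 1) ≤ (10 / 27) ^ 180 := by
    apply exp_neg_le; norm_num
  have n5 : Real.exp (-120) ≤ (10 / 27) ^ 120 := by
    apply exp_neg_le; norm_num
  have n6 : Real.exp (-1153308722614227968 * (933831 / 2 ^ 44) ^ 2 / 4) *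
      Real.exp (1 / 2 * 727.951332655 + (1 / 2) ^ 2 / (2 * (1153308722614227968 / 2))) ≤ (10 / 27) ^ 180 := by
    rw [← Real.exp_add]
    apply exp_neg_le; norm_num
  -- the value at 1
  have g1 : gG 1153308722614227968 727.951332655 (1 / 2 : ℝ) 1 =
      ((Real.exp (1 / 2 * 727.951332655 + (1 / 2) ^ 2 / (2 * 1153308722614227968)) : ℝ) : ℂ) := by
    rw [gG]; push_cast; congr 1; norm_num
  have g2 : gG (4 * 1153308722614227968) (727.951332655 / 2) (1 : ℝ) 1 = 1 := by
    rw [gG]; simp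
  rw [g1] at X1
  rw [g2] at X2
  -- second sum
  have S2 : ‖∑ ρ ∈ Z, (mu ρ : ℂ) * (gG (4 * 1153308722614227968) (727.951332655 / 2) (1 : ℝ) ρ / ρ)‖ ≤
      10 ^ 14 * (2 * (10 / 27) ^ 180) := by
    calc _ ≤ ∑ ρ ∈ Z, ‖(mu ρ : ℂ) * (gG (4 * 1153308722614227968) (727.951332655 / 2) (1 : ℝ) ρ / ρ)‖ := norm_sum_le _ _
      _ ≤ ∑ ρ ∈ Z, (mu ρ : ℝ) * (2 * (10 / 27) ^ 180) := by
        apply Finset.sum_le_sum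
        intro ρ hρ
        rw [norm_mul, norm_div, Complex.norm_natCast]
        gcongr
        have hn : 1 / 2 ≤ ‖ρ‖ := by
          have := Complex.abs_re_le_norm ρ
          rw [hZre ρ hρ] at this
          exact (le_abs_self _).trans this
        have hg := gG_le (a := 4 * 1153308722614227968) (w := 727.951332655 / 2) (κ := 1) (s := ρ) (σ := 1 / 2) (q := 0)
          (by norm_num) (by norm_num) (by norm_num) (by norm_num) (by rw [hZre ρ hρ]; norm_num)
          (by rw [hZre ρ hρ]) (by norm_num) (by positivity)
        have hg2 := hg.trans (exp_neg_le 180 (by norm_num))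
        calc _ ≤ ((10 / 27 : ℝ) ^ 180) / (1 / 2) := by gcongr
          _ = _ := by ring
      _ ≤ _ := by
        rw [← Finset.sum_mul]
        gcongr
        exact count_all Z hZre hZim
  -- first sum
  set t : ℂ → ℂ := fun ρ => (mu ρ : ℂ) * (gG 1153308722614227968 727.951332655 (1 / 2 : ℝ) ρ / ρ) with ht
  have hsplit := Finset.sum_filter_add_sum_filter_not Z (fun ρ => |ρ.im| ≤ 6970346000) t
  set ZT := Z.filter (fun ρ => |ρ.im| ≤ 6970346000) with hZT
  set ZR := Z.filter (fun ρ => ¬ |ρ.im| ≤ 6970346000) with hZR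
  have hset : {ρ : ℂ | IsNontrivialZetaZero ρ ∧ |ρ.im| ≤ 6970346000} = (ZT : Set ℂ) := by
    ext ρ
    simp only [Set.mem_ofPred_eq, hZT, Finset.coe_filter, hZ]
    constructor
    · rintro ⟨h1, h2⟩
      obtain ⟨h3, h4⟩ := nontriv_iff.1 h1
      have h5 := hRH ρ h1 (by linarith)
      have h6 := abs_le.1 h2
      exact ⟨⟨⟨⟨by linarith, by linarith⟩, by linarith, by linarith⟩, h3⟩, h2⟩
    · rintro ⟨⟨h1, h2⟩, h3⟩
      exact ⟨nontriv_iff.2 ⟨h2, by linarith [h1.1.1]⟩, h3⟩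
  rw [hset, finsum_mem_coe_finset] at hsum
  have hST : ∑ ρ ∈ ZT, (zetaZeroMultiplicity ρ : ℂ) *
            (Complex.exp (Complex.I * (ρ.im * (727.951332655 : ℝ))) / ρ *
              Real.exp (-(ρ.im) ^ 2 / (2 * 1153308722614227968))) = ∑ ρ ∈ ZT, t ρ := by
    apply Finset.sum_congr rfl
    intro ρ hρ
    have hρZ := (Finset.mem_filter.1 hρ).1
    have hne : ρ ≠ 1 := by
      intro e; have := hZre ρ hρZ; rw [e] at this; norm_num at this
    simp only [ht]
    rw [gG_half (hZre ρ hρZ), mu_eq hne]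
    ring
  rw [hST] at hsum
  have hSR : ‖∑ ρ ∈ ZR, t ρ‖ ≤ 1.4 * 10 ^ (-9 : ℤ) := by
    have hnt : ∀ ρ ∈ Z, ‖t ρ‖ = (mu ρ : ℝ) * (Real.exp (-ρ.im ^ 2 / (2 * 1153308722614227968)) / ‖ρ‖) := by
      intro ρ hρ
      simp only [ht]
      rw [gG_half (hZre ρ hρ), norm_mul, norm_div, norm_mul, Complex.norm_natCast, Complex.norm_real,
        Real.norm_of_nonneg (Real.exp_pos _).le, mul_comm Complex.I, ← Complex.ofReal_mul, Complex.norm_exp_ofReal_mul_I, one_mul]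
    have h1 : ‖∑ ρ ∈ ZR, t ρ‖ ≤ ∑ ρ ∈ ZR, (mu ρ : ℝ) * (Real.exp (-ρ.im ^ 2 / (2 * 1153308722614227968)) / ‖ρ‖) := by
      refine (norm_sum_le _ _).trans (le_of_eq ?_)
      exact Finset.sum_congr rfl fun ρ hρ => hnt ρ (Finset.mem_filter.1 hρ).1
    refine h1.trans ?_
    rw [← Finset.sum_filter_add_sum_filter_not ZR (fun ρ => 0 ≤ ρ.im)]
    have q1 := tail_one (ε := 1) (Or.inl rfl) (ZR.filter (fun ρ => 0 ≤ ρ.im))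
      (by intro ρ hρ; exact hZre ρ (Finset.mem_filter.1 (Finset.mem_filter.1 hρ).1).1)
      (by
        intro ρ hρ
        have h2 := (Finset.mem_filter.1 hρ).2
        have h3 := (Finset.mem_filter.1 (Finset.mem_filter.1 hρ).1).2
        rw [abs_of_nonneg h2] at h3
        linarith)
      (by
        intro ρ hρ
        have := abs_le.1 (hZim ρ (Finset.mem_filter.1 (Finset.mem_filter.1 hρ).1).1)
        linarith)
    have q2 := tail_one (ε := -1) (Or.inr rfl) (ZR.filter (fun ρ => ¬ 0 ≤ ρ.im))
      (by intro ρ hρ; exact hZre ρ (Finset.mem_filter.1 (Finset.mem_filter.1 hρ).1).1)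
      (by
        intro ρ hρ
        have h2 := (Finset.mem_filter.1 hρ).2
        have h3 := (Finset.mem_filter.1 (Finset.mem_filter.1 hρ).1).2
        push Not at h2
        rw [abs_of_neg h2] at h3
        linarith)
      (by
        intro ρ hρ
        have := abs_le.1 (hZim ρ (Finset.mem_filter.1 (Finset.mem_filter.1 hρ).1).1)
        linarith)
    norm_num at q1 q2 ⊢
    linarith
  -- real parts
  rw [← hsplit] at X1
  have R1 := (Complex.abs_re_le_norm _).trans X1
  have R2 := (Complex.abs_re_le_norm _).trans X2
  have R3 := (Complex.abs_re_le_norm _).trans hSR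
  have R4 := (Complex.abs_re_le_norm _).trans S2
  simp only [Complex.add_re, Complex.sub_re, Complex.ofReal_re, Complex.one_re] at R1 R2
  have R1' := (abs_le.1 R1).1
  have R2' := (abs_le.1 R2).2
  have R3' := (abs_le.1 R3).2
  have R4' := (abs_le.1 R4).1
  have hs2 := hsum.2
  have m33 : ((10:ℝ) / 27) ^ 33 ≤ 1 / 10 ^ 13 := by norm_num
  have m180 : ((10:ℝ) / 27) ^ 180 ≤ 1 / 10 ^ 40 := by norm_num
  have m96 : ((10:ℝ) / 27) ^ 96 ≤ 1 / 10 ^ 13 := by norm_num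
  have m120 : ((10:ℝ) / 27) ^ 120 ≤ 1 / 10 ^ 13 := by norm_num
  have n1' := n1.trans m33
  have n2' := n2.trans m180
  have n3' := n3.trans m96
  have n4' := n4.trans m180
  have n5' := n5.trans m120
  have n6' := n6.trans m180
  rw [mul_assoc 12] at hfinal
  clear n1 n2 n3 n4 n5 n6 m33 m96 m120 X1 X2 S2 hST hset hsplit
  generalize Real.exp ((1.01 - 1 / 2) * 727.951332655 + 1 - H ^ 2 / (2 * 1153308722614227968)) = e1 at *
  generalize Real.exp ((1 / 4 - 1 / 2) * 727.951332655 + 1) = e2 at *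
  generalize Real.exp ((1.01 - 1) * (727.951332655 / 2) + 1 - H ^ 2 / (2 * (4 * 1153308722614227968))) = e3 at *
  generalize Real.exp ((1 / 4 - 1) * (727.951332655 / 2) + 1) = e4 at *
  generalize Real.exp (-120) = e5 at *
  generalize Real.exp (-1153308722614227968 * (933831 / 2 ^ 44) ^ 2 / 4) *
      Real.exp (1 / 2 * 727.951332655 + (1 / 2) ^ 2 / (2 * (1153308722614227968 / 2))) = e6 at *
  generalize ((10:ℝ) / 27) ^ 180 = q at *
  norm_num at *
  linarith

end ZB

theorem crossover_integral_bound (A T α η ω : ℝ)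
    (hA : A = 3.0610046 * 10 ^ 10) (hT : T = 6970346000)
    (hα : α = 1153308722614227968) (hη : η = 933831 / 2 ^ 44)
    (hω : ω = 727.951332655)
    (hRH : ∀ ρ : ℂ, IsNontrivialZetaZero ρ → |ρ.im| ≤ A → ρ.re = 1 / 2)
    (hsum :
      (∑ᶠ ρ ∈ {ρ : ℂ | IsNontrivialZetaZero ρ ∧ |ρ.im| ≤ T},
          (zetaZeroMultiplicity ρ : ℂ) *
            (Complex.exp (Complex.I * (ρ.im * ω)) / ρ *
              Real.exp (-(ρ.im) ^ 2 / (2 * α)))).re ∈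
        Set.Icc (-1.0013360278 : ℝ) (-1.0013360277 : ℝ)) :
    (∫ u in (ω - η)..(ω + η),
        gaussianK α (u - ω) * Real.exp (-u / 2) *
          (chebyshevTheta (Real.exp u) - Real.exp u))
      > 0.0013360261 := by
  subst hT hα hη hω
  apply ZB.main
  · intro ρ h1 h2
    refine hRH ρ h1 ?_
    rw [hA]
    norm_num
    linarith
  · exact hsum
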